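/- A directed graph G uses only chains of parallel paths if and only if G contains none of the four networks M₃, M₃ᵀ, M₃′, M₃″ as a topological minor. -/

import Mathlib

/-- A directed multigraph. -/
structure MultiDigraph where
  V : Type
  E : Type
  src : E → V
  tgt : E → V

namespace MultiDigraph

variable (G : MultiDigraph)

/-- `IsWalkFrom G u v es`: the edge list `es` is a directed walk from `u` to `v`. -/
def IsWalkFrom : G.V → G.V → List G.E → Prop
  | u, v, [] => u = v
  | u, v, e :: es => G.src e = u ∧ IsWalkFrom (G.tgt e) v es

/-- The vertices visited by a walk starting at `u`. -/
def pathVerts (u : G.V) (es : List G.E) : List G.V := u :: es.map G.tgt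

/-- `IsPathFrom G u v es`: `es` is a (simple) directed path from `u` to `v`. -/
def IsPathFrom (u v : G.V) (es : List G.E) : Prop :=
  G.IsWalkFrom u v es ∧ (G.pathVerts u es).Nodup

/-- The internal vertices of a path (all visited vertices except the endpoints). -/
def internals (es : List G.E) : List G.V := (es.map G.tgt).dropLast

/-- The subgraph spanned by a set of edges (on the same vertex set). -/
def edgeSubgraph (S : Set G.E) : MultiDigraph where
  V := G.V
  E := {e // e ∈ S}
  src e := G.src e.val
  tgt e := G.tgt e.val

/-- The transpose (reverse) of a directed multigraph. -/
def transpose : MultiDigraph := ⟨G.V, G.E, G.tgt, G.src⟩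

/-- The set of edges lying on some (simple) directed `u`–`v` path. -/
def pathEdges (u v : G.V) : Set G.E := {e | ∃ es, G.IsPathFrom u v es ∧ e ∈ es}

/-- The union of all directed `u`–`v` paths, as a multidigraph whose vertices are
`u`, `v` and the endpoints of edges lying on some `u`–`v` path. -/
def pathUnion (u v : G.V) : MultiDigraph where
  V := {x // x = u ∨ x = v ∨ ∃ e ∈ G.pathEdges u v, G.src e = x ∨ G.tgt e = x}
  E := {e // e ∈ G.pathEdges u v}
  src e := ⟨G.src e.val, Or.inr (Or.inr ⟨e.val, e.property, Or.inl rfl⟩)⟩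
  tgt e := ⟨G.tgt e.val, Or.inr (Or.inr ⟨e.val, e.property, Or.inr rfl⟩)⟩

/-- `u` is a vertex of `pathUnion G u v`. -/
theorem mem_pathUnion_left (u v : G.V) :
    (u = u ∨ u = v ∨ ∃ e ∈ G.pathEdges u v, G.src e = u ∨ G.tgt e = u) := Or.inl rfl

theorem mem_pathUnion_right (u v : G.V) :
    (v = u ∨ v = v ∨ ∃ e ∈ G.pathEdges u v, G.src e = v ∨ G.tgt e = v) := Or.inr (Or.inl rfl)

/-- A chain of parallel links from `s` to `t`: vertices `v₀ = s, …, v_m = t` in a line,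
every edge goes from some `v_i` to `v_{i+1}`, and every consecutive pair is joined by
at least one edge. -/
def IsChainOfParallelLinks (s t : G.V) : Prop :=
  ∃ (m : ℕ) (v : ℕ → G.V), 0 < m ∧ v 0 = s ∧ v m = t ∧
    (∀ i j, i ≤ m → j ≤ m → v i = v j → i = j) ∧
    (∀ x : G.V, ∃ i, i ≤ m ∧ v i = x) ∧
    (∀ e : G.E, ∃ i, i < m ∧ G.src e = v i ∧ G.tgt e = v (i + 1)) ∧
    (∀ i, i < m → ∃ e : G.E, G.src e = v i ∧ G.tgt e = v (i + 1))

end MultiDigraph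

open MultiDigraph

/-- `IsSubdivisionWith G H φ`: `G` is a subdivision of `H`, where `φ` embeds the
branch vertices of `H` into `G` and each `H`-edge corresponds to a nontrivial path
in `G`; the paths are internally disjoint, edge-disjoint, their internal vertices
avoid branch vertices, and together they exhaust all vertices and edges of `G`. -/
def IsSubdivisionWith (G H : MultiDigraph) (φ : H.V → G.V) : Prop :=
  ∃ P : H.E → List G.E,
    Function.Injective φ ∧
    (∀ e, G.IsPathFrom (φ (H.src e)) (φ (H.tgt e)) (P e) ∧ P e ≠ []) ∧
    (∀ e, ∀ x ∈ G.internals (P e), x ∉ Set.range φ) ∧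
    (∀ e f, e ≠ f → ∀ x ∈ G.internals (P e), x ∉ G.internals (P f)) ∧
    (∀ e f, e ≠ f → ∀ a ∈ P e, a ∉ P f) ∧
    (∀ a : G.E, ∃ e, a ∈ P e) ∧
    (∀ x : G.V, x ∈ Set.range φ ∨ ∃ e, x ∈ G.internals (P e))

/-- `H` is a topological minor of `G`: branch vertices of `H` embed injectively into
`G` and the edges of `H` are realized by internally disjoint, edge-disjoint paths
of `G` avoiding branch vertices internally. -/
def IsTopMinorOf (H G : MultiDigraph) : Prop :=
  ∃ (φ : H.V → G.V) (P : H.E → List G.E),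
    Function.Injective φ ∧
    (∀ e, G.IsPathFrom (φ (H.src e)) (φ (H.tgt e)) (P e) ∧ P e ≠ []) ∧
    (∀ e, ∀ x ∈ G.internals (P e), x ∉ Set.range φ) ∧
    (∀ e f, e ≠ f → ∀ x ∈ G.internals (P e), x ∉ G.internals (P f)) ∧
    (∀ e f, e ≠ f → ∀ a ∈ P e, a ∉ P f)

/-- A chain of parallel paths from `s` to `t`: a subdivision of a chain of
parallel links, with `s` and `t` the images of the endpoints. -/
def IsChainOfParallelPaths (G : MultiDigraph) (s t : G.V) : Prop :=
  ∃ (H : MultiDigraph) (s' t' : H.V) (φ : H.V → G.V),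
    H.IsChainOfParallelLinks s' t' ∧ IsSubdivisionWith G H φ ∧ φ s' = s ∧ φ t' = t

/-- `G` uses only chains of parallel paths: for every ordered pair `(u, v)`,
either there is no (nontrivial) `u`–`v` path, or the union of all `u`–`v` paths
is a chain of parallel paths from `u` to `v`. -/
def UsesOnlyChains (G : MultiDigraph) : Prop :=
  ∀ u v : G.V,
    (¬ ∃ es, G.IsPathFrom u v es ∧ es ≠ []) ∨
    IsChainOfParallelPaths (G.pathUnion u v)
      ⟨u, G.mem_pathUnion_left u v⟩ ⟨v, G.mem_pathUnion_right u v⟩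
/-- The network `M₃`: vertices `s = 0, m = 1, t = 2`; edges
`e₁ = (s,m), e₂ = (m,t), f₁ = (s,t), f₂ = (m,t)`. -/
def M3 : MultiDigraph where
  V := Fin 3
  E := Fin 4
  src := ![0, 1, 0, 1]
  tgt := ![1, 2, 2, 2]

/-- The network `M₃′`: vertices `s = 0, m = 1, w = 2, t = 3`; edges
`(s,m), (m,w), (w,t), (s,t)` and a second parallel edge `(m,w)`. -/
def M3' : MultiDigraph where
  V := Fin 4
  E := Fin 5
  src := ![0, 1, 2, 0, 1]
  tgt := ![1, 2, 3, 3, 2]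

/-- The network `M₃″`: vertices `s = 0, m = 1, w = 2, t = 3`; edges
`(s,m), (m,t), (s,w), (w,t), (m,w)`. -/
def M3'' : MultiDigraph where
  V := Fin 4
  E := Fin 5
  src := ![0, 1, 0, 2, 1]
  tgt := ![1, 3, 2, 3, 2]

/-- Isomorphism of directed multigraphs: bijections on vertices and edges
preserving sources and targets. -/
def MultiDigraph.Iso (G H : MultiDigraph) : Prop :=
  ∃ (φ : G.V ≃ H.V) (ψ : G.E ≃ H.E),
    (∀ e, H.src (ψ e) = φ (G.src e)) ∧ (∀ e, H.tgt (ψ e) = φ (G.tgt e))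

namespace MultiDigraph

variable {G : MultiDigraph}

/-- The `k`-th vertex visited by the walk `es` starting at `u`. -/
def vert : G.V → List G.E → ℕ → G.V
  | u, _, 0 => u
  | u, [], _ + 1 => u
  | _, e :: es, k + 1 => vert (G.tgt e) es k

/-- The part of an edge list between positions `i` and `j`. -/
def seg (es : List G.E) (i j : ℕ) : List G.E := (es.drop i).take (j - i)

@[simp] theorem vert_zero (u : G.V) (es : List G.E) : vert u es 0 = u := by
  cases es <;> rfl

@[simp] theorem vert_cons_succ (u : G.V) (e : G.E) (es : List G.E) (k : ℕ) :
    vert u (e :: es) (k + 1) = vert (G.tgt e) es k := rfl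

theorem pathVerts_getElem? (u : G.V) (es : List G.E) (k : ℕ) (hk : k ≤ es.length) :
    (G.pathVerts u es)[k]? = some (vert u es k) := by
  induction es generalizing u k with
  | nil => simp at hk; subst hk; simp [pathVerts]
  | cons e es ih =>
    cases k with
    | zero => simp [pathVerts]
    | succ k =>
      have := ih (G.tgt e) k (by simpa using hk)
      simpa [pathVerts] using this

theorem length_pathVerts (u : G.V) (es : List G.E) :
    (G.pathVerts u es).length = es.length + 1 := by simp [pathVerts]

theorem mem_pathVerts {u : G.V} {es : List G.E} {x : G.V} :
    x ∈ G.pathVerts u es ↔ ∃ k ≤ es.length, vert u es k = x := by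
  rw [List.mem_iff_getElem?]
  constructor
  · rintro ⟨k, hk⟩
    have hl : k ≤ es.length := by
      have := (List.getElem?_eq_some_iff.1 hk).1
      rw [length_pathVerts] at this; omega
    exact ⟨k, hl, by rw [pathVerts_getElem? u es k hl] at hk; simpa using hk⟩
  · rintro ⟨k, hk, rfl⟩
    exact ⟨k, pathVerts_getElem? u es k hk⟩

theorem nodup_pathVerts {u : G.V} {es : List G.E} :
    (G.pathVerts u es).Nodup ↔
      ∀ i j, i ≤ es.length → j ≤ es.length → vert u es i = vert u es j → i = j := by
  rw [List.nodup_iff_getElem?_ne_getElem?]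
  constructor
  · intro h i j hi hj hij
    by_contra hne
    rcases Nat.lt_or_gt_of_ne hne with hlt | hlt
    · apply h i j hlt (by rw [length_pathVerts]; omega)
      rw [pathVerts_getElem? u es i hi, pathVerts_getElem? u es j hj, hij]
    · apply h j i hlt (by rw [length_pathVerts]; omega)
      rw [pathVerts_getElem? u es i hi, pathVerts_getElem? u es j hj, hij]
  · intro h i j hij hj he
    rw [length_pathVerts] at hj
    rw [pathVerts_getElem? u es i (by omega), pathVerts_getElem? u es j (by omega)] at he
    have := h i j (by omega) (by omega) (by simpa using he)
    omega

theorem mem_internals (u : G.V) {es : List G.E} {x : G.V} :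
    x ∈ G.internals es ↔ ∃ k, 0 < k ∧ k < es.length ∧ vert u es k = x := by
  rw [internals, List.mem_iff_getElem?]
  have key : ∀ k, k + 1 < es.length →
      (es.map G.tgt).dropLast[k]? = some (vert u es (k + 1)) := by
    intro k hk
    have := pathVerts_getElem? u es (k + 1) (by omega)
    rw [List.getElem?_dropLast, if_pos (by simp; omega)]
    simpa [pathVerts] using this
  constructor
  · rintro ⟨k, hk⟩
    have hl : k + 1 < es.length := by
      have := (List.getElem?_eq_some_iff.1 hk).1
      simp at this; omega
    exact ⟨k + 1, by omega, hl, by rw [key k hl] at hk; simpa using hk⟩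
  · rintro ⟨k, h0, hk, rfl⟩
    obtain ⟨k, rfl⟩ : ∃ j, k = j + 1 := ⟨k - 1, by omega⟩
    exact ⟨k, key k hk⟩

theorem mem_map_tgt (u : G.V) {es : List G.E} {x : G.V} :
    x ∈ es.map G.tgt ↔ ∃ k, 0 < k ∧ k ≤ es.length ∧ vert u es k = x := by
  induction es generalizing u with
  | nil => simp
  | cons e es ih =>
    have := mem_pathVerts (u := G.tgt e) (es := es) (x := x)
    rw [pathVerts] at this
    rw [List.map_cons, this]
    constructor
    · rintro ⟨k, hk, rfl⟩
      exact ⟨k + 1, by omega, by simpa using hk, rfl⟩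
    · rintro ⟨k, h0, hk, rfl⟩
      obtain ⟨k, rfl⟩ : ∃ j, k = j + 1 := ⟨k - 1, by omega⟩
      exact ⟨k, by simpa using hk, rfl⟩

theorem IsWalkFrom.vert_length {u v : G.V} {es : List G.E} (h : G.IsWalkFrom u v es) :
    vert u es es.length = v := by
  induction es generalizing u with
  | nil => simpa [IsWalkFrom] using h
  | cons e es ih => exact ih h.2

theorem vert_append_left {u : G.V} {as bs : List G.E} {k : ℕ} (hk : k ≤ as.length) :
    vert u (as ++ bs) k = vert u as k := by
  induction as generalizing u k with
  | nil => simp at hk; subst hk; simp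
  | cons e as ih =>
    cases k with
    | zero => simp
    | succ k => exact ih (by simpa using hk)

theorem vert_append_right {u v : G.V} {as bs : List G.E} (h : G.IsWalkFrom u v as) (k : ℕ) :
    vert u (as ++ bs) (as.length + k) = vert v bs k := by
  induction as generalizing u with
  | nil => cases h; simp
  | cons e as ih =>
    have : (e :: as).length + k = (as.length + k) + 1 := by simp; omega
    rw [this]
    exact ih h.2

theorem isWalkFrom_append {u w : G.V} {as bs : List G.E} :
    G.IsWalkFrom u w (as ++ bs) ↔ ∃ v, G.IsWalkFrom u v as ∧ G.IsWalkFrom v w bs := by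
  induction as generalizing u with
  | nil => simp [IsWalkFrom]
  | cons e as ih => simp [IsWalkFrom, ih, and_assoc]

theorem IsWalkFrom.append {u v w : G.V} {as bs : List G.E} (h : G.IsWalkFrom u v as)
    (h' : G.IsWalkFrom v w bs) : G.IsWalkFrom u w (as ++ bs) :=
  isWalkFrom_append.2 ⟨v, h, h'⟩

theorem IsWalkFrom.end_unique {u v w : G.V} {as : List G.E} (h : G.IsWalkFrom u v as)
    (h' : G.IsWalkFrom u w as) : v = w := by
  rw [← h.vert_length, ← h'.vert_length]

theorem IsWalkFrom.take {u v : G.V} {es : List G.E} (h : G.IsWalkFrom u v es) {k : ℕ}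
    (hk : k ≤ es.length) : G.IsWalkFrom u (vert u es k) (es.take k) := by
  induction es generalizing u k with
  | nil => simp at hk; subst hk; simp [IsWalkFrom]
  | cons e es ih =>
    cases k with
    | zero => simp [IsWalkFrom]
    | succ k => exact ⟨h.1, ih h.2 (by simpa using hk)⟩

theorem IsWalkFrom.drop {u v : G.V} {es : List G.E} (h : G.IsWalkFrom u v es) {k : ℕ}
    (hk : k ≤ es.length) : G.IsWalkFrom (vert u es k) v (es.drop k) := by
  induction es generalizing u k with
  | nil => simp at hk; subst hk; simpa using h
  | cons e es ih =>
    cases k with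
    | zero => simpa using h
    | succ k => exact ih h.2 (by simpa using hk)

theorem IsWalkFrom.vert_drop {u v : G.V} {es : List G.E} (h : G.IsWalkFrom u v es) {i : ℕ}
    (hi : i ≤ es.length) (k : ℕ) : vert (vert u es i) (es.drop i) k = vert u es (i + k) := by
  have := vert_append_right (bs := es.drop i) (h.take hi) k
  rw [List.take_append_drop, List.length_take, min_eq_left hi] at this
  exact this.symm

theorem vert_take {u : G.V} {es : List G.E} {j k : ℕ} (hk : k ≤ j) (hj : j ≤ es.length) :
    vert u (es.take j) k = vert u es k := by
  conv_rhs => rw [← List.take_append_drop j es]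
  rw [vert_append_left (by simp; omega)]

theorem length_seg {es : List G.E} {i j : ℕ} (hj : j ≤ es.length) :
    (seg es i j).length = j - i := by
  simp [seg]; omega

theorem IsWalkFrom.seg {u v : G.V} {es : List G.E} (h : G.IsWalkFrom u v es) {i j : ℕ}
    (hij : i ≤ j) (hj : j ≤ es.length) :
    G.IsWalkFrom (vert u es i) (vert u es j) (seg es i j) := by
  have := (h.drop (k := i) (by omega)).take (k := j - i) (by simp; omega)
  rwa [h.vert_drop (by omega), Nat.add_sub_cancel' hij] at this

theorem IsWalkFrom.vert_seg {u v : G.V} {es : List G.E} (h : G.IsWalkFrom u v es) {i j k : ℕ}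
    (hk : i + k ≤ j) (hj : j ≤ es.length) :
    vert (vert u es i) (MultiDigraph.seg es i j) k = vert u es (i + k) := by
  rw [MultiDigraph.seg, vert_take (by omega) (by simp; omega), h.vert_drop (by omega)]

theorem IsPathFrom.inj {u v : G.V} {es : List G.E} (h : G.IsPathFrom u v es) {i j : ℕ}
    (hi : i ≤ es.length) (hj : j ≤ es.length) (hij : vert u es i = vert u es j) : i = j :=
  nodup_pathVerts.1 h.2 i j hi hj hij

theorem IsPathFrom.seg {u v : G.V} {es : List G.E} (h : G.IsPathFrom u v es) {i j : ℕ}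
    (hij : i ≤ j) (hj : j ≤ es.length) :
    G.IsPathFrom (vert u es i) (vert u es j) (seg es i j) := by
  refine ⟨h.1.seg hij hj, nodup_pathVerts.2 fun a b ha hb hab => ?_⟩
  rw [length_seg hj] at ha hb
  rw [h.1.vert_seg (by omega) hj, h.1.vert_seg (by omega) hj] at hab
  have := h.inj (by omega) (by omega) hab
  omega

theorem IsWalkFrom.mem_internals_seg {u v : G.V} {es : List G.E} (h : G.IsWalkFrom u v es)
    {i j : ℕ} (hj : j ≤ es.length) {x : G.V} :
    x ∈ G.internals (MultiDigraph.seg es i j) ↔ ∃ k, i < k ∧ k < j ∧ vert u es k = x := by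
  rw [mem_internals (vert u es i), length_seg hj]
  constructor
  · rintro ⟨k, h0, hk, rfl⟩
    exact ⟨i + k, by omega, by omega, (h.vert_seg (by omega) hj).symm⟩
  · rintro ⟨k, h0, hk, rfl⟩
    refine ⟨k - i, by omega, by omega, ?_⟩
    rw [h.vert_seg (by omega) hj]
    congr 1; omega

theorem seg_ne_nil {es : List G.E} {i j : ℕ} (hij : i < j) (hj : j ≤ es.length) :
    seg es i j ≠ [] := by
  rw [← List.length_pos_iff, length_seg hj]; omega

theorem IsPathFrom.append {u v w : G.V} {as bs : List G.E} (h : G.IsPathFrom u v as)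
    (h' : G.IsPathFrom v w bs) (hd : ∀ x ∈ G.pathVerts u as, x ∉ bs.map G.tgt) :
    G.IsPathFrom u w (as ++ bs) := by
  refine ⟨h.1.append h'.1, ?_⟩
  have : G.pathVerts u (as ++ bs) = G.pathVerts u as ++ bs.map G.tgt := by simp [pathVerts]
  rw [this, List.nodup_append]
  exact ⟨h.2, (List.nodup_cons.1 h'.2).2, fun a ha b hb hab => hd a ha (hab ▸ hb)⟩

theorem IsWalkFrom.mem_pathVerts_iff {u v : G.V} {es : List G.E} (h : G.IsWalkFrom u v es)
    {x : G.V} : x ∈ G.pathVerts u es ↔ x = u ∨ x ∈ G.internals es ∨ x = v := by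
  rw [mem_pathVerts, mem_internals u]
  constructor
  · rintro ⟨k, hk, rfl⟩
    rcases Nat.eq_zero_or_pos k with rfl | h0
    · exact Or.inl (by simp)
    · rcases hk.lt_or_eq with hk | rfl
      · exact Or.inr (Or.inl ⟨k, h0, hk, rfl⟩)
      · exact Or.inr (Or.inr h.vert_length)
  · rintro (rfl | ⟨k, h0, hk, rfl⟩ | rfl)
    · exact ⟨0, by omega, by simp⟩
    · exact ⟨k, hk.le, rfl⟩
    · exact ⟨_, le_rfl, h.vert_length⟩

theorem IsWalkFrom.mem_map_tgt_iff {u v : G.V} {es : List G.E} (h : G.IsWalkFrom u v es)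
    (hn : es ≠ []) {x : G.V} : x ∈ es.map G.tgt ↔ x ∈ G.internals es ∨ x = v := by
  rw [mem_map_tgt u, mem_internals u]
  have := List.length_pos_iff.2 hn
  constructor
  · rintro ⟨k, h0, hk, rfl⟩
    rcases hk.lt_or_eq with hk | rfl
    · exact Or.inl ⟨k, h0, hk, rfl⟩
    · exact Or.inr h.vert_length
  · rintro (⟨k, h0, hk, rfl⟩ | rfl)
    · exact ⟨k, h0, hk.le, rfl⟩
    · exact ⟨_, this, le_rfl, h.vert_length⟩

theorem IsWalkFrom.mem_internals_append {u v : G.V} {as bs : List G.E}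
    (h : G.IsWalkFrom u v as) (ha : as ≠ []) (hb : bs ≠ []) {x : G.V} :
    x ∈ G.internals (as ++ bs) ↔ x ∈ G.internals as ∨ x = v ∨ x ∈ G.internals bs := by
  have : G.internals (as ++ bs) = as.map G.tgt ++ G.internals bs := by
    rw [internals, List.map_append, List.dropLast_append_of_ne_nil (by simpa using hb), internals]
  rw [this, List.mem_append, h.mem_map_tgt_iff ha, or_assoc]

theorem IsPathFrom.start_ne_end {u v : G.V} {es : List G.E} (h : G.IsPathFrom u v es)
    (hn : es ≠ []) : u ≠ v := by
  intro he
  have h0 := List.length_pos_iff.2 hn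
  have := h.inj (i := 0) (j := es.length) (by omega) le_rfl (by rw [h.1.vert_length]; simp [he])
  omega

theorem IsPathFrom.start_notMem {u v : G.V} {es : List G.E} (h : G.IsPathFrom u v es) :
    u ∉ G.internals es := by
  rw [mem_internals u]
  rintro ⟨k, h0, hk, he⟩
  have := h.inj (i := k) (j := 0) (by omega) (by omega) (by simpa using he)
  omega

theorem IsPathFrom.end_notMem {u v : G.V} {es : List G.E} (h : G.IsPathFrom u v es) :
    v ∉ G.internals es := by
  rw [mem_internals u]
  rintro ⟨k, h0, hk, he⟩
  have := h.inj (i := k) (j := es.length) (by omega) (by omega) (by rw [h.1.vert_length, he])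
  omega

/-- Concatenation of two nontrivial paths, with disjointness phrased via internal vertices. -/
theorem IsPathFrom.append' {u v w : G.V} {as bs : List G.E} (h : G.IsPathFrom u v as)
    (h' : G.IsPathFrom v w bs) (hb : bs ≠ []) (huw : u ≠ w) (hu : u ∉ G.internals bs)
    (hw : w ∉ G.internals as) (hd : ∀ x ∈ G.internals as, x ∉ G.internals bs) :
    G.IsPathFrom u w (as ++ bs) := by
  refine h.append h' fun x hx hx' => ?_
  rw [h.1.mem_pathVerts_iff] at hx
  rw [h'.1.mem_map_tgt_iff hb] at hx'
  rcases hx with rfl | hx | rfl <;> rcases hx' with hx' | hx'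
  · exact hu hx'
  · exact huw hx'
  · exact hd _ hx hx'
  · exact hw (hx' ▸ hx)
  · exact h'.start_notMem hx'
  · exact absurd hx' (h'.start_ne_end hb)

/-- Every walk contains a path with the same ends. -/
theorem IsWalkFrom.exists_path {u v : G.V} {es : List G.E} (h : G.IsWalkFrom u v es) :
    ∃ fs, G.IsPathFrom u v fs ∧ ∀ x ∈ G.pathVerts u fs, x ∈ G.pathVerts u es := by
  induction es generalizing u with
  | nil => exact ⟨[], ⟨h, by simp [pathVerts]⟩, fun x hx => hx⟩
  | cons e es ih =>
    obtain ⟨fs, hfs, hsub⟩ := ih h.2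
    by_cases hu : u ∈ G.pathVerts (G.tgt e) fs
    · obtain ⟨k, hk, rfl⟩ := mem_pathVerts.1 hu
      have hp := hfs.seg (i := k) (j := fs.length) hk le_rfl
      rw [hfs.1.vert_length] at hp
      refine ⟨_, hp, fun x hx => ?_⟩
      obtain ⟨l, hl, rfl⟩ := mem_pathVerts.1 hx
      rw [length_seg le_rfl] at hl
      rw [hfs.1.vert_seg (by omega) le_rfl]
      exact List.mem_cons_of_mem _ (hsub _ (mem_pathVerts.2 ⟨k + l, by omega, rfl⟩))
    · refine ⟨e :: fs, ⟨⟨h.1, hfs.1⟩, List.nodup_cons.2 ⟨hu, hfs.2⟩⟩, fun x hx => ?_⟩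
      rcases List.mem_cons.1 hx with rfl | hx
      · exact List.mem_cons_self
      · exact List.mem_cons_of_mem _ (hsub _ hx)

/-- A walk ending in `p` has a first vertex in `p` after any position before its end. -/
theorem exists_first_hit (p : G.V → Prop) {u v : G.V} {es : List G.E} (h : G.IsWalkFrom u v es)
    {i : ℕ} (hi : i < es.length) (hv : p v) :
    ∃ k, i < k ∧ k ≤ es.length ∧ p (vert u es k) ∧ ∀ l, i < l → l < k → ¬ p (vert u es l) := by
  classical
  have hex : ∃ k, i < k ∧ k ≤ es.length ∧ p (vert u es k) :=
    ⟨es.length, hi, le_rfl, by rwa [h.vert_length]⟩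
  obtain ⟨h1, h2, h3⟩ := Nat.find_spec hex
  exact ⟨_, h1, h2, h3, fun l hl hlk hp => Nat.find_min hex hlk ⟨hl, by omega, hp⟩⟩

/-- A path starting in `p` has a last vertex in `p`. -/
theorem exists_last_hit (p : G.V → Prop) {u : G.V} (es : List G.E) (hu : p u) :
    ∃ k, k ≤ es.length ∧ p (vert u es k) ∧ ∀ l, k < l → l ≤ es.length → ¬ p (vert u es l) := by
  classical
  have h0 : p (vert u es 0) := by simpa using hu
  refine ⟨_, Nat.findGreatest_le es.length,
    Nat.findGreatest_spec (P := fun k => p (vert u es k)) (Nat.zero_le _) h0, fun l hl hl' => ?_⟩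
  exact Nat.findGreatest_is_greatest hl hl'

theorem IsWalkFrom.mem_edge {u v : G.V} {es : List G.E} (h : G.IsWalkFrom u v es) {a : G.E}
    (ha : a ∈ es) : ∃ k < es.length, G.src a = vert u es k ∧ G.tgt a = vert u es (k + 1) ∧
      es[k]? = some a := by
  induction es generalizing u with
  | nil => simp at ha
  | cons e es ih =>
    rcases List.mem_cons.1 ha with rfl | ha
    · exact ⟨0, by simp, by simpa using h.1, by simp, by simp⟩
    · obtain ⟨k, hk, h1, h2, h3⟩ := ih h.2 ha
      exact ⟨k + 1, by simpa using hk, h1, h2, by simpa using h3⟩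

theorem IsPathFrom.eq_of_src_eq {u v : G.V} {es : List G.E} (h : G.IsPathFrom u v es) {a b : G.E}
    (ha : a ∈ es) (hb : b ∈ es) (hab : G.src a = G.src b) : a = b := by
  obtain ⟨k, hk, h1, -, h3⟩ := h.1.mem_edge ha
  obtain ⟨l, hl, h1', -, h3'⟩ := h.1.mem_edge hb
  have := h.inj hk.le hl.le (h1.symm.trans (hab.trans h1'))
  subst this
  simpa [h3] using h3'

theorem IsPathFrom.eq_of_tgt_eq {u v : G.V} {es : List G.E} (h : G.IsPathFrom u v es) {a b : G.E}
    (ha : a ∈ es) (hb : b ∈ es) (hab : G.tgt a = G.tgt b) : a = b := by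
  obtain ⟨k, hk, -, h1, h3⟩ := h.1.mem_edge ha
  obtain ⟨l, hl, -, h1', h3'⟩ := h.1.mem_edge hb
  have : k = l := by
    have := h.inj hk hl (h1.symm.trans (hab.trans h1'))
    omega
  subst this
  simpa [h3] using h3'

theorem IsWalkFrom.src_mem {u v : G.V} {es : List G.E} (h : G.IsWalkFrom u v es) {a : G.E}
    (ha : a ∈ es) : G.src a = u ∨ G.src a ∈ G.internals es := by
  obtain ⟨k, hk, h1, -⟩ := h.mem_edge ha
  rcases Nat.eq_zero_or_pos k with rfl | h0
  · exact Or.inl (by simpa using h1)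
  · exact Or.inr ((mem_internals u).2 ⟨k, h0, hk, h1.symm⟩)

theorem IsWalkFrom.tgt_mem {u v : G.V} {es : List G.E} (h : G.IsWalkFrom u v es) {a : G.E}
    (ha : a ∈ es) : G.tgt a ∈ G.internals es ∨ G.tgt a = v :=
  (h.mem_map_tgt_iff (List.ne_nil_of_mem ha)).1 (List.mem_map_of_mem ha)

theorem IsPathFrom.eq_singleton {u v : G.V} {es : List G.E} (h : G.IsPathFrom u v es) {a : G.E}
    (ha : a ∈ es) (hs : G.src a = u) (ht : G.tgt a = v) : es = [a] := by
  obtain ⟨k, hk, h1, h2, h3⟩ := h.1.mem_edge ha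
  have hk0 : k = 0 := h.inj hk.le (Nat.zero_le _) (by rw [← h1, hs, vert_zero])
  have hk1 : k + 1 = es.length := h.inj hk le_rfl (by rw [← h2, ht, h.1.vert_length])
  subst hk0
  obtain ⟨b, rfl⟩ := List.length_eq_one_iff.1 hk1.symm
  simpa using h3

theorem IsWalkFrom.ne_nil {u v : G.V} {es : List G.E} (h : G.IsWalkFrom u v es) (huv : u ≠ v) :
    es ≠ [] := by
  rintro rfl
  exact huv h

/-- Internally disjoint paths avoiding branch vertices are edge-disjoint as soon as the paths
replacing parallel edges are distinct. -/
theorem edge_disjoint_of_internals {H : MultiDigraph} {φ : H.V → G.V} {P : H.E → List G.E}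
    (hφ : Function.Injective φ)
    (hP : ∀ e, G.IsPathFrom (φ (H.src e)) (φ (H.tgt e)) (P e))
    (hI : ∀ e, ∀ x ∈ G.internals (P e), x ∉ Set.range φ)
    (hD : ∀ e f, e ≠ f → ∀ x ∈ G.internals (P e), x ∉ G.internals (P f))
    (hpar : ∀ e f, e ≠ f → H.src e = H.src f → H.tgt e = H.tgt f → P e ≠ P f) :
    ∀ e f, e ≠ f → ∀ a ∈ P e, a ∉ P f := by
  intro e f hef a hae haf
  have hs : G.src a = φ (H.src e) ∧ G.src a = φ (H.src f) := by
    rcases (hP e).1.src_mem hae with h1 | h1 <;> rcases (hP f).1.src_mem haf with h2 | h2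
    · exact ⟨h1, h2⟩
    · exact absurd ⟨_, h1.symm⟩ (hI f _ h2)
    · exact absurd ⟨_, h2.symm⟩ (hI e _ h1)
    · exact absurd h2 (hD e f hef _ h1)
  have ht : G.tgt a = φ (H.tgt e) ∧ G.tgt a = φ (H.tgt f) := by
    rcases (hP e).1.tgt_mem hae with h1 | h1 <;> rcases (hP f).1.tgt_mem haf with h2 | h2
    · exact absurd h2 (hD e f hef _ h1)
    · exact absurd ⟨_, h2.symm⟩ (hI e _ h1)
    · exact absurd ⟨_, h1.symm⟩ (hI f _ h2)
    · exact ⟨h1, h2⟩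
  refine hpar e f hef (hφ (hs.1.symm.trans hs.2)) (hφ (ht.1.symm.trans ht.2)) ?_
  rw [(hP e).eq_singleton hae hs.1 ht.1, (hP f).eq_singleton haf hs.2 ht.2]

theorem isTopMinorOf_fin {k n : ℕ} (src tgt : Fin n → Fin k) (φ : Fin k → G.V)
    (P : Fin n → List G.E) (hφ : ∀ i j, i < j → φ i ≠ φ j)
    (hst : ∀ e, src e ≠ tgt e)
    (hP : ∀ e, G.IsPathFrom (φ (src e)) (φ (tgt e)) (P e))
    (hI : ∀ e, ∀ i, φ i ∉ G.internals (P e))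
    (hD : ∀ e f, e < f → (G.internals (P e)).Disjoint (G.internals (P f)))
    (hpar : ∀ e f, e < f → src e = src f → tgt e = tgt f → P e ≠ P f) :
    IsTopMinorOf ⟨Fin k, Fin n, src, tgt⟩ G := by
  have hφ' : Function.Injective φ := by
    intro i j hij
    by_contra hne
    rcases lt_or_gt_of_ne hne with h | h
    · exact hφ _ _ h hij
    · exact hφ _ _ h hij.symm
  have hI' : ∀ e, ∀ x ∈ G.internals (P e), x ∉ Set.range φ := by
    rintro e x hx ⟨i, rfl⟩
    exact hI e i hx
  have hD' : ∀ e f, e ≠ f → ∀ x ∈ G.internals (P e), x ∉ G.internals (P f) := by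
    intro e f hne x hx hx'
    rcases lt_or_gt_of_ne hne with h | h
    · exact hD _ _ h hx hx'
    · exact hD _ _ h hx' hx
  refine ⟨φ, P, hφ', fun e => ⟨hP e, (hP e).1.ne_nil fun h => hst e (hφ' h)⟩, hI', hD', ?_⟩
  refine edge_disjoint_of_internals (H := ⟨Fin k, Fin n, src, tgt⟩) hφ' hP hI' hD' ?_
  intro e f hne h1 h2 h3
  rcases lt_or_gt_of_ne hne with h | h
  · exact hpar _ _ h h1 h2 h3
  · exact hpar _ _ h h1.symm h2.symm h3.symm

theorem isTopMinorOf_M3 {s m t : G.V} {A C R D : List G.E} (hsm : s ≠ m) (hst : s ≠ t)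
    (hmt : m ≠ t) (hA : G.IsPathFrom s m A) (hC : G.IsPathFrom m t C) (hR : G.IsPathFrom s t R)
    (hD : G.IsPathFrom m t D) (tA : t ∉ G.internals A) (sC : s ∉ G.internals C)
    (mR : m ∉ G.internals R) (sD : s ∉ G.internals D)
    (AC : (G.internals A).Disjoint (G.internals C)) (AR : (G.internals A).Disjoint (G.internals R))
    (AD : (G.internals A).Disjoint (G.internals D)) (CR : (G.internals C).Disjoint (G.internals R))
    (CD : (G.internals C).Disjoint (G.internals D)) (RD : (G.internals R).Disjoint (G.internals D))
    (hne : C ≠ D) : IsTopMinorOf M3 G := by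
  refine isTopMinorOf_fin _ _ ![s, m, t] ![A, C, R, D] ?_ ?_ ?_ ?_ ?_ ?_
  · simp [Fin.forall_fin_succ, *]
  · decide
  · simp [Fin.forall_fin_succ, *]
  · simp [Fin.forall_fin_succ, *, hA.start_notMem, hA.end_notMem, hC.start_notMem, hC.end_notMem,
      hR.start_notMem, hR.end_notMem, hD.start_notMem, hD.end_notMem]
  · simp [Fin.forall_fin_succ, *]
  · simp [Fin.forall_fin_succ, *]

theorem isTopMinorOf_M3_transpose {s m t : G.V} {A C R D : List G.E} (hsm : s ≠ m) (hst : s ≠ t)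
    (hmt : m ≠ t) (hA : G.IsPathFrom s m A) (hC : G.IsPathFrom m t C) (hR : G.IsPathFrom s t R)
    (hD : G.IsPathFrom s m D) (tA : t ∉ G.internals A) (sC : s ∉ G.internals C)
    (mR : m ∉ G.internals R) (tD : t ∉ G.internals D)
    (AC : (G.internals A).Disjoint (G.internals C)) (AR : (G.internals A).Disjoint (G.internals R))
    (AD : (G.internals A).Disjoint (G.internals D)) (CR : (G.internals C).Disjoint (G.internals R))
    (CD : (G.internals C).Disjoint (G.internals D)) (RD : (G.internals R).Disjoint (G.internals D))
    (hne : A ≠ D) : IsTopMinorOf M3.transpose G := by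
  refine isTopMinorOf_fin ![1, 2, 2, 2] ![0, 1, 0, 1] ![t, m, s] ![C, A, R, D] ?_ ?_ ?_ ?_ ?_ ?_
  · simp [Fin.forall_fin_succ, hsm.symm, hst.symm, hmt.symm]
  · decide
  · simp [Fin.forall_fin_succ, *]
  · simp [Fin.forall_fin_succ, *, hA.start_notMem, hA.end_notMem, hC.start_notMem, hC.end_notMem,
      hR.start_notMem, hR.end_notMem, hD.start_notMem, hD.end_notMem]
  · simp [Fin.forall_fin_succ, *, AC.symm]
  · simp [Fin.forall_fin_succ, *]

theorem isTopMinorOf_M3' {s m w t : G.V} {A B C R D : List G.E} (hsm : s ≠ m) (hsw : s ≠ w)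
    (hst : s ≠ t) (hmw : m ≠ w) (hmt : m ≠ t) (hwt : w ≠ t)
    (hA : G.IsPathFrom s m A) (hB : G.IsPathFrom m w B) (hC : G.IsPathFrom w t C)
    (hR : G.IsPathFrom s t R) (hD : G.IsPathFrom m w D)
    (wA : w ∉ G.internals A) (tA : t ∉ G.internals A)
    (sB : s ∉ G.internals B) (tB : t ∉ G.internals B)
    (sC : s ∉ G.internals C) (mC : m ∉ G.internals C)
    (mR : m ∉ G.internals R) (wR : w ∉ G.internals R)
    (sD : s ∉ G.internals D) (tD : t ∉ G.internals D)
    (AB : (G.internals A).Disjoint (G.internals B)) (AC : (G.internals A).Disjoint (G.internals C))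
    (AR : (G.internals A).Disjoint (G.internals R)) (AD : (G.internals A).Disjoint (G.internals D))
    (BC : (G.internals B).Disjoint (G.internals C)) (BR : (G.internals B).Disjoint (G.internals R))
    (BD : (G.internals B).Disjoint (G.internals D)) (CR : (G.internals C).Disjoint (G.internals R))
    (CD : (G.internals C).Disjoint (G.internals D)) (RD : (G.internals R).Disjoint (G.internals D))
    (hne : B ≠ D) : IsTopMinorOf M3' G := by
  refine isTopMinorOf_fin _ _ ![s, m, w, t] ![A, B, C, R, D] ?_ ?_ ?_ ?_ ?_ ?_
  · simp [Fin.forall_fin_succ, *]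
  · decide
  · simp [Fin.forall_fin_succ, *]
  · simp [Fin.forall_fin_succ, *, hA.start_notMem, hA.end_notMem, hB.start_notMem, hB.end_notMem,
      hC.start_notMem, hC.end_notMem, hR.start_notMem, hR.end_notMem, hD.start_notMem,
      hD.end_notMem]
  · simp [Fin.forall_fin_succ, *]
  · simp [Fin.forall_fin_succ, *]

theorem isTopMinorOf_M3'' {s m w t : G.V} {A B C R D : List G.E} (hsm : s ≠ m) (hsw : s ≠ w)
    (hst : s ≠ t) (hmw : m ≠ w) (hmt : m ≠ t) (hwt : w ≠ t)
    (hA : G.IsPathFrom s m A) (hB : G.IsPathFrom m t B) (hC : G.IsPathFrom s w C)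
    (hR : G.IsPathFrom w t R) (hD : G.IsPathFrom m w D)
    (wA : w ∉ G.internals A) (tA : t ∉ G.internals A)
    (sB : s ∉ G.internals B) (wB : w ∉ G.internals B)
    (mC : m ∉ G.internals C) (tC : t ∉ G.internals C)
    (sR : s ∉ G.internals R) (mR : m ∉ G.internals R)
    (sD : s ∉ G.internals D) (tD : t ∉ G.internals D)
    (AB : (G.internals A).Disjoint (G.internals B)) (AC : (G.internals A).Disjoint (G.internals C))
    (AR : (G.internals A).Disjoint (G.internals R)) (AD : (G.internals A).Disjoint (G.internals D))
    (BC : (G.internals B).Disjoint (G.internals C)) (BR : (G.internals B).Disjoint (G.internals R))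
    (BD : (G.internals B).Disjoint (G.internals D)) (CR : (G.internals C).Disjoint (G.internals R))
    (CD : (G.internals C).Disjoint (G.internals D))
    (RD : (G.internals R).Disjoint (G.internals D)) :
    IsTopMinorOf M3'' G := by
  refine isTopMinorOf_fin _ _ ![s, m, w, t] ![A, B, C, R, D] ?_ ?_ ?_ ?_ ?_ ?_
  · simp [Fin.forall_fin_succ, *]
  · decide
  · simp [Fin.forall_fin_succ, *]
  · simp [Fin.forall_fin_succ, *, hA.start_notMem, hA.end_notMem, hB.start_notMem, hB.end_notMem,
      hC.start_notMem, hC.end_notMem, hR.start_notMem, hR.end_notMem, hD.start_notMem,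
      hD.end_notMem]
  · simp [Fin.forall_fin_succ, *]
  · simp [Fin.forall_fin_succ]

/-- `R` is a path between positions `i < j` of the walk `P` avoiding `P` internally. -/
structure IsEar (u : G.V) (P : List G.E) (i j : ℕ) (R : List G.E) : Prop where
  lt : i < j
  le : j ≤ P.length
  path : G.IsPathFrom (vert u P i) (vert u P j) R
  notMem : ∀ k ≤ P.length, vert u P k ∉ G.internals R

theorem IsPathFrom.vert_ne {u v : G.V} {P : List G.E} (hP : G.IsPathFrom u v P) {i j : ℕ}
    (hij : i < j) (hj : j ≤ P.length) : vert u P i ≠ vert u P j := fun h => by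
  have := hP.inj (by omega) hj h
  omega

theorem IsPathFrom.notMem_seg {u v : G.V} {P : List G.E} (hP : G.IsPathFrom u v P) {i j k : ℕ}
    (hj : j ≤ P.length) (hk : k ≤ P.length) (h : k ≤ i ∨ j ≤ k) :
    vert u P k ∉ G.internals (MultiDigraph.seg P i j) := by
  rw [hP.1.mem_internals_seg hj]
  rintro ⟨l, h1, h2, h3⟩
  have := hP.inj (by omega) hk h3
  omega

theorem IsPathFrom.seg_disjoint {u v : G.V} {P : List G.E} (hP : G.IsPathFrom u v P)
    {i j i' j' : ℕ} (h : j ≤ i') (hi : i' ≤ j') (hj : j' ≤ P.length) :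
    (G.internals (MultiDigraph.seg P i j)).Disjoint
      (G.internals (MultiDigraph.seg P i' j')) := by
  intro x hx hx'
  rw [hP.1.mem_internals_seg (by omega)] at hx hx'
  obtain ⟨k, h1, h2, rfl⟩ := hx
  obtain ⟨l, h3, h4, h5⟩ := hx'
  have := hP.inj (by omega) (by omega) h5
  omega

theorem IsWalkFrom.seg_disjoint_of_notMem {u v : G.V} {P R : List G.E} (hP : G.IsWalkFrom u v P)
    (hR : ∀ k ≤ P.length, vert u P k ∉ G.internals R) {i j : ℕ} (hj : j ≤ P.length) :
    (G.internals (MultiDigraph.seg P i j)).Disjoint (G.internals R) := by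
  intro x hx hx'
  rw [hP.mem_internals_seg hj] at hx
  obtain ⟨k, h1, h2, rfl⟩ := hx
  exact hR k (by omega) hx'

theorem internals_seg_subset {es : List G.E} {u v : G.V} (h : G.IsWalkFrom u v es) {i j : ℕ}
    (hj : j ≤ es.length) {x : G.V} (hx : x ∈ G.internals (MultiDigraph.seg es i j)) :
    x ∈ G.internals es := by
  rw [h.mem_internals_seg hj] at hx
  obtain ⟨k, h1, h2, rfl⟩ := hx
  exact (mem_internals u).2 ⟨k, by omega, by omega, rfl⟩

theorem IsEar.overlap {u v : G.V} {P : List G.E} (hP : G.IsPathFrom u v P) {i₁ j₁ i₂ j₂ : ℕ}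
    {R₁ R₂ : List G.E} (h₁ : IsEar u P i₁ j₁ R₁) (h₂ : IsEar u P i₂ j₂ R₂) (h12 : i₁ < i₂)
    (h21 : i₂ < j₁) (hj : j₁ < j₂) : IsTopMinorOf M3'' G ∨ ∃ R, IsEar u P i₁ j₂ R := by
  have hl := h₂.le
  by_cases hd : (G.internals R₁).Disjoint (G.internals R₂)
  · left
    exact isTopMinorOf_M3'' (hP.vert_ne h12 (by omega)) (hP.vert_ne (by omega) (by omega))
      (hP.vert_ne (by omega) hl) (hP.vert_ne h21 (by omega)) (hP.vert_ne (by omega) hl)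
      (hP.vert_ne hj hl) (hP.seg h12.le (by omega)) h₂.path h₁.path (hP.seg hj.le hl)
      (hP.seg h21.le (by omega))
      (hP.notMem_seg (by omega) (by omega) (by omega))
      (hP.notMem_seg (by omega) (by omega) (by omega))
      (h₂.notMem _ (by omega)) (h₂.notMem _ (by omega))
      (h₁.notMem _ (by omega)) (h₁.notMem _ (by omega))
      (hP.notMem_seg (by omega) (by omega) (by omega))
      (hP.notMem_seg (by omega) (by omega) (by omega))
      (hP.notMem_seg (by omega) (by omega) (by omega))
      (hP.notMem_seg (by omega) (by omega) (by omega))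
      (hP.1.seg_disjoint_of_notMem h₂.notMem (by omega))
      (hP.1.seg_disjoint_of_notMem h₁.notMem (by omega))
      (hP.seg_disjoint (by omega) (by omega) (by omega))
      (hP.seg_disjoint (by omega) (by omega) (by omega)) hd.symm
      (hP.1.seg_disjoint_of_notMem h₂.notMem (by omega)).symm
      (hP.1.seg_disjoint_of_notMem h₂.notMem (by omega)).symm
      (hP.1.seg_disjoint_of_notMem h₁.notMem (by omega)).symm
      (hP.1.seg_disjoint_of_notMem h₁.notMem (by omega)).symm
      (hP.seg_disjoint (by omega) (by omega) (by omega)).symm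
  · right
    simp only [List.Disjoint, not_forall] at hd
    obtain ⟨r, hr₁, hr₂, -⟩ := hd
    obtain ⟨a, ha0, ha, rfl⟩ := (mem_internals (vert u P i₁)).1 hr₁
    obtain ⟨k, hk0, hk, hpk, hmin⟩ := exists_first_hit
      (fun x => x ∈ G.internals R₂ ∨ x = vert u P j₁) h₁.path.1 (i := 0) (by omega) (Or.inr rfl)
    have hka : k ≤ a := by
      by_contra hlt
      exact hmin a ha0 (by omega) (Or.inl hr₂)
    have hmem : vert (vert u P i₁) R₁ k ∈ G.internals R₂ := by
      refine hpk.resolve_right fun h => ?_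
      have := h₁.path.inj hk le_rfl (by rw [h, h₁.path.1.vert_length])
      omega
    obtain ⟨b, hb0, hb, hbk⟩ := (mem_internals (vert u P i₂)).1 hmem
    have hs₁ := h₁.path.seg (Nat.zero_le k) hk
    have hs₂ := h₂.path.seg hb.le le_rfl
    rw [vert_zero] at hs₁
    rw [h₂.path.1.vert_length, hbk] at hs₂
    have hn₁ := seg_ne_nil hk0 hk
    have hn₂ := seg_ne_nil hb le_rfl
    refine ⟨seg R₁ 0 k ++ seg R₂ b R₂.length, by omega, hl, hs₁.append' hs₂ hn₂
      (hP.vert_ne (by omega) hl) ?_ ?_ ?_, ?_⟩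
    · exact fun h => h₂.notMem i₁ (by omega) (internals_seg_subset h₂.path.1 le_rfl h)
    · exact fun h => h₁.notMem j₂ (by omega) (internals_seg_subset h₁.path.1 hk h)
    · intro x hx hx'
      rw [h₁.path.1.mem_internals_seg hk] at hx
      obtain ⟨l, hl0, hlk, rfl⟩ := hx
      exact hmin l hl0 hlk (Or.inl (internals_seg_subset h₂.path.1 le_rfl hx'))
    · intro l hl hmem'
      rw [hs₁.1.mem_internals_append hn₁ hn₂] at hmem'
      rcases hmem' with h | h | h
      · exact h₁.notMem l hl (internals_seg_subset h₁.path.1 hk h)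
      · exact h₂.notMem l hl (h ▸ hmem)
      · exact h₂.notMem l hl (internals_seg_subset h₂.path.1 le_rfl h)

theorem exists_ear_of_avoid {u v : G.V} {P Q : List G.E} (hP : G.IsPathFrom u v P) {k : ℕ}
    (hk : k ≤ P.length) (hQ : G.IsPathFrom u v Q) (hkQ : vert u P k ∉ G.pathVerts u Q) :
    ∃ i j R, IsEar u P i j R ∧ i < k ∧ k < j := by
  have hk0 : k ≠ 0 := by
    rintro rfl
    exact hkQ (by simp [pathVerts])
  have hkl : k ≠ P.length := by
    rintro rfl
    rw [hP.1.vert_length, hQ.1.mem_pathVerts_iff] at hkQ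
    simp at hkQ
  obtain ⟨a, ha, ⟨i, hik, hia⟩, hamax⟩ := exists_last_hit
    (fun x => ∃ i < k, vert u P i = x) (u := u) Q ⟨0, by omega, by simp⟩
  have haQ : a < Q.length := by
    refine lt_of_le_of_ne ha ?_
    rintro rfl
    rw [hQ.1.vert_length, ← hP.1.vert_length] at hia
    have := hP.inj (by omega) le_rfl hia
    omega
  obtain ⟨b, hab, hb, ⟨j, hkj, hj, hjb⟩, hbmin⟩ := exists_first_hit
    (fun x => ∃ j, k ≤ j ∧ j ≤ P.length ∧ vert u P j = x) hQ.1 haQ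
    ⟨P.length, hk, le_rfl, hP.1.vert_length⟩
  have hkj' : k ≠ j := by
    rintro rfl
    exact hkQ (mem_pathVerts.2 ⟨b, hb, hjb.symm⟩)
  have hs := hQ.seg hab.le hb
  rw [← hia, ← hjb] at hs
  refine ⟨i, j, seg Q a b, ⟨by omega, hj, hs, ?_⟩, hik, by omega⟩
  intro l hl h
  rw [hQ.1.mem_internals_seg hb] at h
  obtain ⟨c, hac, hcb, hc⟩ := h
  rcases lt_or_ge l k with hlk | hlk
  · exact hamax c hac (by omega) ⟨l, hlk, hc.symm⟩
  · exact hbmin c hac hcb ⟨l, hlk, hl, hc.symm⟩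

/-- `c` lies on every path from `u` to `v`. -/
def IsCut (u v c : G.V) : Prop := ∀ Q, G.IsPathFrom u v Q → c ∈ G.pathVerts u Q

theorem isCut_left (u v : G.V) : IsCut u v u := fun Q _ => by simp [pathVerts]

theorem isCut_right (u v : G.V) : IsCut u v v := fun Q hQ => by simp [hQ.1.mem_pathVerts_iff]

theorem IsCut.mem_of_walk {u v c : G.V} (hc : IsCut u v c) {Q : List G.E}
    (hQ : G.IsWalkFrom u v Q) : c ∈ G.pathVerts u Q := by
  obtain ⟨Q', hQ', hsub⟩ := hQ.exists_path
  exact hsub _ (hc _ hQ')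

theorem exists_ear_of_not_isCut {u v : G.V} {P : List G.E} (hP : G.IsPathFrom u v P) {k : ℕ}
    (hk : k ≤ P.length) (hc : ¬ IsCut u v (vert u P k)) :
    ∃ i j R, IsEar u P i j R ∧ i < k ∧ k < j := by
  simp only [IsCut, not_forall] at hc
  obtain ⟨Q, hQ, hkQ⟩ := hc
  exact exists_ear_of_avoid hP hk hQ hkQ

/-- In the absence of `M₃″`, a maximal ear ends in cut vertices. -/
theorem exists_ear_between_cuts (hM : ¬ IsTopMinorOf M3'' G) {u v : G.V} {P : List G.E}
    (hP : G.IsPathFrom u v P) {k : ℕ} (hk : k ≤ P.length) (hc : ¬ IsCut u v (vert u P k)) :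
    ∃ i j R, IsEar u P i j R ∧ i < k ∧ k < j ∧ IsCut u v (vert u P i) ∧
      IsCut u v (vert u P j) := by
  suffices H : ∀ n i j R, P.length - (j - i) ≤ n → IsEar u P i j R → i < k → k < j →
      ∃ i j R, IsEar u P i j R ∧ i < k ∧ k < j ∧ IsCut u v (vert u P i) ∧
        IsCut u v (vert u P j) by
    obtain ⟨i, j, R, h, h1, h2⟩ := exists_ear_of_not_isCut hP hk hc
    exact H _ i j R le_rfl h h1 h2
  intro n
  induction n with
  | zero =>
    intro i j R hn h hik hkj
    have hj := h.le
    obtain rfl : i = 0 := by omega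
    obtain rfl : j = P.length := by omega
    refine ⟨0, _, R, h, hik, hkj, ?_, ?_⟩
    · rw [vert_zero]; exact isCut_left u v
    · rw [hP.1.vert_length]; exact isCut_right u v
  | succ n ih =>
    intro i j R hn h hik hkj
    have hj := h.le
    by_cases hci : IsCut u v (vert u P i)
    · by_cases hcj : IsCut u v (vert u P j)
      · exact ⟨i, j, R, h, hik, hkj, hci, hcj⟩
      · obtain ⟨i', j', R', h', h1, h2⟩ := exists_ear_of_not_isCut hP hj hcj
        have hj' := h'.le
        rcases le_or_gt i' i with hi' | hi'
        · exact ih i' j' R' (by omega) h' (by omega) (by omega)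
        · obtain ⟨R'', h''⟩ := (h.overlap hP h' hi' h1 h2).resolve_left hM
          exact ih i j' R'' (by omega) h'' hik (by omega)
    · obtain ⟨i', j', R', h', h1, h2⟩ := exists_ear_of_not_isCut hP (by omega) hci
      have hj' := h'.le
      rcases le_or_gt j j' with hjj | hjj
      · exact ih i' j' R' (by omega) h' (by omega) (by omega)
      · obtain ⟨R'', h''⟩ := (h'.overlap hP h h1 h2 hjj).resolve_left hM
        exact ih i' j R'' (by omega) h'' (by omega) hkj

theorem exists_common_prefix {α : Type*} (S P : List α) :
    ∃ K S' P', S = K ++ S' ∧ P = K ++ P' ∧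
      (S' = [] ∨ P' = [] ∨ ∃ f s e p, S' = f :: s ∧ P' = e :: p ∧ f ≠ e) := by
  induction S generalizing P with
  | nil => exact ⟨[], [], P, by simp⟩
  | cons f s ih =>
    cases P with
    | nil => exact ⟨[], f :: s, [], by simp⟩
    | cons e p =>
      by_cases h : f = e
      · subst h
        obtain ⟨K, S', P', h1, h2, h3⟩ := ih p
        exact ⟨f :: K, S', P', by simp [h1], by simp [h2], h3⟩
      · exact ⟨[], f :: s, e :: p, rfl, rfl, Or.inr (Or.inr ⟨f, s, e, p, rfl, rfl, h⟩)⟩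

theorem head?_seg {es : List G.E} {i j : ℕ} (hij : i < j) : (seg es i j).head? = es[i]? := by
  rw [seg, List.head?_take, if_neg (by omega), List.head?_drop]

/-- If `P` and `R` are internally disjoint paths, another path with the same ends that starts
with the same edge as `P` must be `P`, or else one of the forbidden networks appears. -/
theorem eq_of_head?_eq (hM : ¬ IsTopMinorOf M3 G) (hM' : ¬ IsTopMinorOf M3' G)
    (hM'' : ¬ IsTopMinorOf M3'' G) {y z : G.V} {P R S : List G.E} (hyz : y ≠ z)
    (hP : G.IsPathFrom y z P) (hR : G.IsPathFrom y z R)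
    (hPR : (G.internals P).Disjoint (G.internals R)) (hS : G.IsPathFrom y z S)
    (hh : S.head? = P.head?) : S = P := by
  obtain ⟨K, S', P', hSK, hPK, hcase⟩ := exists_common_prefix S P
  have hPn := hP.1.ne_nil hyz
  have hSn := hS.1.ne_nil hyz
  have hSw := hS.1
  have hPw := hP.1
  rw [hSK, isWalkFrom_append] at hSw
  rw [hPK, isWalkFrom_append] at hPw
  obtain ⟨x, hK, hS'⟩ := hSw
  obtain ⟨x', hK', hP'⟩ := hPw
  obtain rfl := hK.end_unique hK'
  have hxS : vert y S K.length = x := by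
    rw [hSK, vert_append_left le_rfl, hK.vert_length]
  have hxP : vert y P K.length = x := by
    rw [hPK, vert_append_left le_rfl, hK.vert_length]
  have hlS : S.length = K.length + S'.length := by rw [hSK, List.length_append]
  have hlP : P.length = K.length + P'.length := by rw [hPK, List.length_append]
  rcases hcase with h | h | ⟨f, s, e, p, hf, he, hfe⟩
  · subst h
    obtain rfl : x = z := hS'
    have := hP.inj (by omega) le_rfl (hxP.trans hP.1.vert_length.symm)
    have : P' = [] := List.length_eq_zero_iff.1 (by omega)
    rw [hSK, hPK, this]
  · subst h
    obtain rfl : x = z := hP'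
    have := hS.inj (by omega) le_rfl (hxS.trans hS.1.vert_length.symm)
    have : S' = [] := List.length_eq_zero_iff.1 (by omega)
    rw [hSK, hPK, this]
  exfalso
  have hK0 : 0 < K.length := by
    rw [List.length_pos_iff]
    rintro rfl
    rw [hSK, hPK, hf, he] at hh
    simp [hfe] at hh
  generalize hk : K.length = k at *
  have hSk : k < S.length := by rw [hlS, hf]; simp
  have hPk : k < P.length := by rw [hlP, he]; simp
  have hSf : S[k]? = some f := by rw [hSK, hf, List.getElem?_append_right (by omega)]; simp [hk]
  have hPe : P[k]? = some e := by rw [hPK, he, List.getElem?_append_right (by omega)]; simp [hk]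
  have hRP : ∀ i ≤ P.length, vert y P i ∉ G.internals R := by
    intro i hi h
    have hi' : vert y P i ∈ G.pathVerts y P := mem_pathVerts.2 ⟨i, hi, rfl⟩
    rw [hP.1.mem_pathVerts_iff] at hi'
    rcases hi' with h' | h' | h'
    · exact hR.start_notMem (h' ▸ h)
    · exact hPR h' h
    · exact hR.end_notMem (h' ▸ h)
  obtain ⟨l, hkl, hl, hpl, hmin⟩ := exists_first_hit
    (fun w => w ∈ G.pathVerts y P ∨ w ∈ G.internals R) hS.1 hSk
    (Or.inl (by simp [hP.1.mem_pathVerts_iff]))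
  have hD := hS.seg hkl.le hl
  rw [hxS, ← hxP] at hD
  have hDP : ∀ i ≤ P.length, vert y P i ∉ G.internals (seg S k l) := by
    intro i hi h
    rw [hS.1.mem_internals_seg hl] at h
    obtain ⟨m, h1, h2, h3⟩ := h
    exact hmin m h1 h2 (Or.inl (mem_pathVerts.2 ⟨i, hi, h3.symm⟩))
  have hDR : (G.internals R).Disjoint (G.internals (seg S k l)) := by
    intro w hw h
    rw [hS.1.mem_internals_seg hl] at h
    obtain ⟨m, h1, h2, rfl⟩ := h
    exact hmin m h1 h2 (Or.inr hw)
  have hA := hP.seg (Nat.zero_le k) hPk.le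
  have hC := hP.seg hPk.le le_rfl
  have hsm := hP.vert_ne hK0 hPk.le
  have hmt := hP.vert_ne hPk le_rfl
  rw [vert_zero] at hA hsm
  rw [hP.1.vert_length] at hC hmt
  have hnot := fun {i j m : ℕ} (h1 : j ≤ P.length) (h2 : m ≤ P.length) (h3 : m ≤ i ∨ j ≤ m) =>
    hP.notMem_seg h1 h2 h3
  have hy : ∀ {i j : ℕ}, j ≤ P.length → y ∉ G.internals (seg P i j) := fun {i j} hj => by
    have := hnot (i := i) hj (Nat.zero_le _) (Or.inl (Nat.zero_le _))
    rwa [vert_zero] at this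
  have hz : ∀ {i j : ℕ}, j ≤ P.length → z ∉ G.internals (seg P i j) := fun {i j} hj => by
    have := hnot (i := i) hj le_rfl (Or.inr hj)
    rwa [hP.1.vert_length] at this
  have hyD : y ∉ G.internals (seg S k l) := by simpa using hDP 0 (by omega)
  have hzD : z ∉ G.internals (seg S k l) := by simpa [hP.1.vert_length] using hDP _ le_rfl
  have hne : ∀ j, k < j → seg P k j ≠ seg S k l := by
    intro j hj h
    have := congrArg List.head? h
    rw [head?_seg hj, head?_seg hkl, hSf, hPe] at this
    exact hfe (by simpa using this.symm)
  by_cases hd : vert y S l ∈ G.pathVerts y P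
  · obtain ⟨j, hj, hjl⟩ := mem_pathVerts.1 hd
    have hkj : k < j := by
      by_contra hlt
      have : vert y S j = vert y P j := by
        rw [hSK, hPK, vert_append_left (by omega), vert_append_left (by omega)]
      have := hS.inj (by omega) hl (this.trans hjl)
      omega
    rw [← hjl] at hD
    rcases hj.lt_or_eq with hj' | rfl
    · have hwt := hP.vert_ne hj' le_rfl
      have hsw := hP.vert_ne (i := 0) (j := j) (by omega) hj
      have hC' := hP.seg hj le_rfl
      rw [vert_zero] at hsw
      rw [hP.1.vert_length] at hwt hC'
      exact hM' (isTopMinorOf_M3' hsm hsw hyz (hP.vert_ne hkj hj) hmt hwt hA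
        (hP.seg hkj.le hj) hC' hR hD
        (hnot (by omega) (by omega) (by omega)) (hz (by omega)) (hy (by omega)) (hz (by omega))
        (hy (by omega)) (hnot (by omega) (by omega) (by omega)) (hRP _ (by omega))
        (hRP _ (by omega)) hyD hzD
        (hP.seg_disjoint (by omega) (by omega) (by omega))
        (hP.seg_disjoint (by omega) (by omega) (by omega))
        (hP.1.seg_disjoint_of_notMem hRP (by omega))
        (hP.1.seg_disjoint_of_notMem hDP (by omega))
        (hP.seg_disjoint (by omega) (by omega) (by omega))
        (hP.1.seg_disjoint_of_notMem hRP (by omega))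
        (hP.1.seg_disjoint_of_notMem hDP (by omega))
        (hP.1.seg_disjoint_of_notMem hRP (by omega))
        (hP.1.seg_disjoint_of_notMem hDP (by omega)) hDR (hne j hkj))
    · rw [hP.1.vert_length] at hD
      exact hM (isTopMinorOf_M3 hsm hyz hmt hA hC hR hD (hz (by omega)) (hy (by omega))
        (hRP _ (by omega)) hyD
        (hP.seg_disjoint (by omega) (by omega) (by omega))
        (hP.1.seg_disjoint_of_notMem hRP (by omega))
        (hP.1.seg_disjoint_of_notMem hDP (by omega))
        (hP.1.seg_disjoint_of_notMem hRP (by omega))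
        (hP.1.seg_disjoint_of_notMem hDP (by omega)) hDR (hne _ hkj))
  · obtain ⟨r, hr0, hr, hrl⟩ := (mem_internals y).1 (hpl.resolve_left hd)
    rw [← hrl] at hD hd
    have hdP : ∀ {i j : ℕ}, j ≤ P.length → vert y R r ∉ G.internals (seg P i j) := by
      intro i j hj h
      rw [hP.1.mem_internals_seg hj] at h
      obtain ⟨m, h1, h2, h3⟩ := h
      exact hd (mem_pathVerts.2 ⟨m, by omega, h3⟩)
    have hR₁ := hR.seg (Nat.zero_le r) hr.le
    have hR₂ := hR.seg hr.le le_rfl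
    have hsw := hR.vert_ne hr0 hr.le
    have hwt := hR.vert_ne hr le_rfl
    rw [vert_zero] at hR₁ hsw
    rw [hR.1.vert_length] at hR₂ hwt
    have hRP' : ∀ i j, j ≤ R.length → ∀ m ≤ P.length, vert y P m ∉ G.internals (seg R i j) :=
      fun i j hj m hm h => hRP m hm (internals_seg_subset hR.1 hj h)
    have hDR' : ∀ i j, j ≤ R.length →
        (G.internals (seg R i j)).Disjoint (G.internals (seg S k l)) :=
      fun i j hj w hw h => hDR (internals_seg_subset hR.1 hj hw) h
    have hmw : vert y P k ≠ vert y R r := fun h => hd (mem_pathVerts.2 ⟨k, hPk.le, h⟩)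
    exact hM'' (isTopMinorOf_M3'' hsm hsw hyz hmw hmt hwt hA hC hR₁ hR₂ hD
      (hdP (by omega)) (hz (by omega)) (hy (by omega)) (hdP (by omega))
      (hRP' _ _ (by omega) _ (by omega))
      (fun h => hR.end_notMem (internals_seg_subset hR.1 hr.le h))
      (fun h => hR.start_notMem (internals_seg_subset hR.1 le_rfl h))
      (hRP' _ _ (by omega) _ (by omega)) hyD hzD
      (hP.seg_disjoint (by omega) (by omega) (by omega))
      (hP.1.seg_disjoint_of_notMem (hRP' _ _ (by omega)) (by omega))
      (hP.1.seg_disjoint_of_notMem (hRP' _ _ (by omega)) (by omega))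
      (hP.1.seg_disjoint_of_notMem hDP (by omega))
      (hP.1.seg_disjoint_of_notMem (hRP' _ _ (by omega)) (by omega))
      (hP.1.seg_disjoint_of_notMem (hRP' _ _ (by omega)) (by omega))
      (hP.1.seg_disjoint_of_notMem hDP (by omega))
      (hR.seg_disjoint (by omega) (by omega) (by omega))
      (hDR' _ _ (by omega)) (hDR' _ _ (by omega)))

/-- If `P` and `R` are internally disjoint paths and the first vertex of `S` meeting either of
them lies inside `P`, then `S = P`, or else one of the forbidden networks appears. -/
theorem eq_of_first_hit (hM : ¬ IsTopMinorOf M3 G) (hMT : ¬ IsTopMinorOf M3.transpose G)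
    (hM' : ¬ IsTopMinorOf M3' G)
    (hM'' : ¬ IsTopMinorOf M3'' G) {y z : G.V} {P R S : List G.E} (hyz : y ≠ z)
    (hP : G.IsPathFrom y z P) (hR : G.IsPathFrom y z R)
    (hPR : (G.internals P).Disjoint (G.internals R)) (hS : G.IsPathFrom y z S) {l : ℕ}
    (hl0 : 0 < l) (hl : l ≤ S.length) (hd : vert y S l ∈ G.internals P)
    (hmin : ∀ m, 0 < m → m < l → vert y S m ∉ G.internals P ∧ vert y S m ∉ G.internals R ∧
      vert y S m ≠ z) : S = P := by
  obtain ⟨k, hk0, hk, hkl⟩ := (mem_internals y).1 hd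
  have hD := hS.seg (Nat.zero_le l) hl
  rw [vert_zero, ← hkl] at hD
  by_cases heq : seg P 0 k = seg S 0 l
  · refine eq_of_head?_eq hM hM' hM'' hyz hP hR hPR hS ?_
    have := congrArg List.head? heq
    rw [head?_seg hk0, head?_seg hl0] at this
    rw [List.head?_eq_getElem?, List.head?_eq_getElem?, this]
  exfalso
  have hA := hP.seg (Nat.zero_le k) hk.le
  have hC := hP.seg hk.le le_rfl
  have hsm := hP.vert_ne hk0 hk.le
  have hmt := hP.vert_ne hk le_rfl
  rw [vert_zero] at hA hsm
  rw [hP.1.vert_length] at hC hmt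
  have hPD : (G.internals P).Disjoint (G.internals (seg S 0 l)) := by
    intro w hw h
    rw [hS.1.mem_internals_seg hl] at h
    obtain ⟨m, h1, h2, rfl⟩ := h
    exact (hmin m h1 h2).1 hw
  have hRD : (G.internals R).Disjoint (G.internals (seg S 0 l)) := by
    intro w hw h
    rw [hS.1.mem_internals_seg hl] at h
    obtain ⟨m, h1, h2, rfl⟩ := h
    exact (hmin m h1 h2).2.1 hw
  have hzD : z ∉ G.internals (seg S 0 l) := by
    intro h
    rw [hS.1.mem_internals_seg hl] at h
    obtain ⟨m, h1, h2, h3⟩ := h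
    exact (hmin m h1 h2).2.2 h3
  exact hMT (isTopMinorOf_M3_transpose hsm hyz hmt hA hC hR hD
    (fun h => hP.end_notMem (internals_seg_subset hP.1 hk.le h))
    (fun h => hP.start_notMem (internals_seg_subset hP.1 le_rfl h))
    (fun h => hPR (hkl ▸ hd) h) hzD
    (hP.seg_disjoint (by omega) (by omega) (by omega))
    (fun w h => hPR (internals_seg_subset hP.1 hk.le h))
    (fun w h => hPD (internals_seg_subset hP.1 hk.le h))
    (fun w h => hPR (internals_seg_subset hP.1 le_rfl h))
    (fun w h => hPD (internals_seg_subset hP.1 le_rfl h)) hRD heq)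

/-- A path sharing an internal vertex with one of two internally disjoint paths with the same
ends coincides with it. -/
theorem eq_of_shared_internal (hM : ¬ IsTopMinorOf M3 G) (hMT : ¬ IsTopMinorOf M3.transpose G)
    (hM' : ¬ IsTopMinorOf M3' G)
    (hM'' : ¬ IsTopMinorOf M3'' G) {y z : G.V} {P R S : List G.E} (hyz : y ≠ z)
    (hP : G.IsPathFrom y z P) (hR : G.IsPathFrom y z R)
    (hPR : (G.internals P).Disjoint (G.internals R)) (hS : G.IsPathFrom y z S) {x : G.V}
    (hxS : x ∈ G.internals S) (hxP : x ∈ G.internals P) : S = P := by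
  obtain ⟨a, ha0, ha, rfl⟩ := (mem_internals y).1 hxS
  obtain ⟨l, hl0, hl, hp, hmin⟩ := exists_first_hit
    (fun w => w ∈ G.internals P ∨ w ∈ G.internals R ∨ w = z) hS.1 (i := 0) (by omega)
    (Or.inr (Or.inr rfl))
  have hla : l ≤ a := by
    by_contra h
    exact hmin a ha0 (by omega) (Or.inl hxP)
  rcases hp with hp | hp | hp
  · refine eq_of_first_hit hM hMT hM' hM'' hyz hP hR hPR hS hl0 hl hp fun m h1 h2 => ?_
    have := hmin m h1 h2
    tauto
  · have hSR : S = R := by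
      refine eq_of_first_hit hM hMT hM' hM'' hyz hR hP hPR.symm hS hl0 hl hp fun m h1 h2 => ?_
      have := hmin m h1 h2
      tauto
    exact absurd (hSR ▸ hxS) (hPR hxP)
  · have := hS.inj hl le_rfl (hp.trans hS.1.vert_length.symm)
    omega

theorem IsWalkFrom.mem_map_tgt_seg {u v : G.V} {es : List G.E} (h : G.IsWalkFrom u v es)
    {i j : ℕ} (hj : j ≤ es.length) {x : G.V} :
    x ∈ (MultiDigraph.seg es i j).map G.tgt ↔ ∃ k, i < k ∧ k ≤ j ∧ vert u es k = x := by
  rw [mem_map_tgt (vert u es i), length_seg hj]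
  constructor
  · rintro ⟨k, h0, hk, rfl⟩
    exact ⟨i + k, by omega, by omega, (h.vert_seg (by omega) hj).symm⟩
  · rintro ⟨k, h0, hk, rfl⟩
    refine ⟨k - i, by omega, by omega, ?_⟩
    rw [h.vert_seg (by omega) hj]
    congr 1; omega

theorem IsWalkFrom.mem_pathVerts_seg {u v : G.V} {es : List G.E} (h : G.IsWalkFrom u v es)
    {i j : ℕ} (hij : i ≤ j) (hj : j ≤ es.length) {x : G.V} :
    x ∈ G.pathVerts (vert u es i) (MultiDigraph.seg es i j) ↔
      ∃ k, i ≤ k ∧ k ≤ j ∧ vert u es k = x := by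
  rw [pathVerts, List.mem_cons, h.mem_map_tgt_seg hj]
  constructor
  · rintro (rfl | ⟨k, h0, hk, rfl⟩)
    · exact ⟨i, le_rfl, hij, rfl⟩
    · exact ⟨k, h0.le, hk, rfl⟩
  · rintro ⟨k, h0, hk, rfl⟩
    rcases h0.lt_or_eq with h0 | rfl
    · exact Or.inr ⟨k, h0, hk, rfl⟩
    · exact Or.inl rfl

theorem mem_pathVerts_append {u x : G.V} {as bs : List G.E} :
    x ∈ G.pathVerts u (as ++ bs) ↔ x ∈ G.pathVerts u as ∨ x ∈ bs.map G.tgt := by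
  simp [pathVerts, or_assoc]

/-- Vertices strictly below an ear are not cut vertices. -/
theorem IsEar.not_isCut {u v : G.V} {P R : List G.E} {i j : ℕ} (h : IsEar u P i j R)
    (hP : G.IsPathFrom u v P) {k : ℕ} (hik : i < k) (hkj : k < j) :
    ¬ IsCut u v (vert u P k) := by
  intro hc
  have hlt := h.lt
  have hj := h.le
  have h0 := hP.1.seg (Nat.zero_le i) (by omega)
  have h1 := hP.1.seg hj le_rfl
  rw [vert_zero] at h0
  rw [hP.1.vert_length] at h1
  have hmem := hc.mem_of_walk ((h0.append h.path.1).append h1)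
  rw [mem_pathVerts_append, mem_pathVerts_append, hP.1.mem_map_tgt_seg le_rfl,
    h.path.1.mem_map_tgt_iff (h.path.1.ne_nil (hP.vert_ne hlt hj))] at hmem
  have h0' := hP.1.mem_pathVerts_seg (x := vert u P k) (Nat.zero_le i) (by omega)
  rw [vert_zero] at h0'
  rw [h0'] at hmem
  rcases hmem with (⟨l, -, hl, he⟩ | he | he) | ⟨l, hl, hl', he⟩
  · have := hP.inj (by omega) (by omega) he
    omega
  · exact h.notMem k (by omega) he
  · have := hP.inj (by omega) (by omega) he
    omega
  · have := hP.inj (by omega) (by omega) he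
    omega

/-- A cut vertex separates the vertices before it from those after it consistently on all
paths. -/
theorem IsCut.lt_of_lt {u v : G.V} {P P' : List G.E} (hP : G.IsPathFrom u v P)
    (hP' : G.IsPathFrom u v P') {a b a' b' : ℕ} (ha : a ≤ P.length)
    (ha' : a' ≤ P'.length) (hb' : b' ≤ P'.length) (hc : IsCut u v (vert u P a))
    (haa : vert u P a = vert u P' a') (hbb : vert u P b = vert u P' b') (hab : b < a) :
    b' < a' := by
  by_contra hlt
  have h0 := hP.1.seg (Nat.zero_le b) (by omega)
  have h1 := hP'.1.seg hb' le_rfl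
  rw [vert_zero] at h0
  rw [hP'.1.vert_length, ← hbb] at h1
  have hmem := hc.mem_of_walk (h0.append h1)
  have h0' := hP.1.mem_pathVerts_seg (x := vert u P a) (Nat.zero_le b) (by omega)
  rw [vert_zero] at h0'
  rw [mem_pathVerts_append, hP'.1.mem_map_tgt_seg le_rfl, h0'] at hmem
  rcases hmem with ⟨l, -, hl, he⟩ | ⟨l, hl, hl', he⟩
  · have := hP.inj (by omega) ha he
    omega
  · have := hP'.inj hl' ha' (he.trans haa)
    omega

/-- Positions `i < j` on the path `P` carrying consecutive cut vertices. -/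
structure IsCutInterval (u v : G.V) (P : List G.E) (i j : ℕ) : Prop where
  lt : i < j
  le : j ≤ P.length
  left : IsCut u v (vert u P i)
  right : IsCut u v (vert u P j)
  inner : ∀ k, i < k → k < j → ¬ IsCut u v (vert u P k)

theorem IsCutInterval.unique {u v : G.V} {P : List G.E} {i j i' j' k : ℕ}
    (h : IsCutInterval u v P i j) (h' : IsCutInterval u v P i' j') (hik : i < k) (hkj : k < j)
    (hik' : i' < k) (hkj' : k < j') : i = i' ∧ j = j' := by
  constructor
  · by_contra hne
    rcases Nat.lt_or_gt_of_ne hne with hlt | hlt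
    · exact h.inner _ hlt (by omega) h'.left
    · exact h'.inner _ hlt (by omega) h.left
  · by_contra hne
    rcases Nat.lt_or_gt_of_ne hne with hlt | hlt
    · exact h'.inner _ (by omega) hlt h.right
    · exact h.inner _ (by omega) hlt h'.right

theorem exists_isCutInterval {u v : G.V} {P : List G.E} (hP : G.IsPathFrom u v P) {k : ℕ}
    (hk : k < P.length) : ∃ i j, IsCutInterval u v P i j ∧ i ≤ k ∧ k < j := by
  classical
  obtain ⟨j, hkj, hj, hcj, hjmin⟩ := exists_first_hit (IsCut u v) hP.1 hk (isCut_right u v)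
  have h0 : IsCut u v (vert u P 0) := by rw [vert_zero]; exact isCut_left u v
  have hi := Nat.findGreatest_le (P := fun i => IsCut u v (vert u P i)) k
  refine ⟨Nat.findGreatest (fun i => IsCut u v (vert u P i)) k, j, ⟨by omega, hj,
    Nat.findGreatest_spec (P := fun i => IsCut u v (vert u P i)) (Nat.zero_le k) h0, hcj,
    fun l h1 h2 => ?_⟩, hi, hkj⟩
  rcases le_or_gt l k with hl | hl
  · exact Nat.findGreatest_is_greatest h1 hl
  · exact hjmin l hl h2

/-- Consecutive cut vertices on one path are consecutive on every other path. -/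
theorem IsCutInterval.transfer {u v : G.V} {P P' : List G.E} (hP : G.IsPathFrom u v P)
    (hP' : G.IsPathFrom u v P') {i j : ℕ} (h : IsCutInterval u v P i j) :
    ∃ i' j', IsCutInterval u v P' i' j' ∧ vert u P' i' = vert u P i ∧
      vert u P' j' = vert u P j := by
  have hlt := h.lt
  have hle := h.le
  obtain ⟨i', hi', hii⟩ := mem_pathVerts.1 (h.left _ hP')
  obtain ⟨j', hj', hjj⟩ := mem_pathVerts.1 (h.right _ hP')
  refine ⟨i', j', ⟨IsCut.lt_of_lt hP hP' hle hj' hi' h.right hjj.symm hii.symm hlt, hj',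
    hii ▸ h.left, hjj ▸ h.right, fun k h1 h2 hc => ?_⟩, hii, hjj⟩
  obtain ⟨l, hl, hlk⟩ := mem_pathVerts.1 (hc _ hP)
  have h3 : i < l := IsCut.lt_of_lt hP' hP (by omega) hl (by omega) hc hlk.symm hii h1
  have h4 : l < j := IsCut.lt_of_lt hP' hP hj' hle hl (hjj ▸ h.right) hjj hlk.symm h2
  exact h.inner l h3 h4 (hlk ▸ hc)

/-- In the absence of the forbidden networks, two paths between consecutive cut vertices which
share an internal vertex coincide. -/
theorem IsCutInterval.seg_eq (hM : ¬ IsTopMinorOf M3 G) (hMT : ¬ IsTopMinorOf M3.transpose G)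
    (hM' : ¬ IsTopMinorOf M3' G) (hM'' : ¬ IsTopMinorOf M3'' G) {u v : G.V}
    {P P' : List G.E} (hP : G.IsPathFrom u v P) (hP' : G.IsPathFrom u v P') {i j i' j' k k' : ℕ}
    (h : IsCutInterval u v P i j) (h' : IsCutInterval u v P' i' j') (hik : i < k) (hkj : k < j)
    (hik' : i' < k') (hkj' : k' < j') (hkk : vert u P' k' = vert u P k) :
    seg P' i' j' = seg P i j ∧ vert u P' i' = vert u P i ∧ vert u P' j' = vert u P j := by
  have hle := h.le
  have hle' := h'.le
  obtain ⟨a, b, R, hR, hak, hkb, hca, hcb⟩ :=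
    exists_ear_between_cuts hM'' hP (by omega) (h.inner k hik hkj)
  obtain ⟨rfl, rfl⟩ := h.unique
    ⟨hR.lt, hR.le, hca, hcb, fun l h1 h2 => hR.not_isCut hP h1 h2⟩ hik hkj hak hkb
  obtain ⟨a, b, hab, hai, hbj⟩ := h.transfer hP hP'
  have hablt := hab.lt
  have hable := hab.le
  have h3 : a < k' := by
    by_contra hlt
    have hne : a ≠ k' := by
      rintro rfl
      exact h'.inner a hik' hkj' hab.left
    have := IsCut.lt_of_lt hP' hP (by omega) (by omega) (by omega) hab.left hai hkk
      (b := k') (by omega)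
    omega
  have h4 : k' < b := IsCut.lt_of_lt hP hP' hle hable (by omega) h.right hbj.symm hkk.symm hkj
  obtain ⟨rfl, rfl⟩ := hab.unique h' h3 h4 hik' hkj'
  refine ⟨?_, hai, hbj⟩
  have hS := hP'.seg hablt.le hable
  rw [hai, hbj] at hS
  refine eq_of_shared_internal hM hMT hM' hM'' (hP.vert_ne h.lt hle) (hP.seg h.lt.le hle)
    hR.path (hP.1.seg_disjoint_of_notMem hR.notMem hle) hS (x := vert u P k) ?_ ?_
  · rw [hP'.1.mem_internals_seg hable]
    exact ⟨k', h3, h4, hkk⟩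
  · rw [hP.1.mem_internals_seg hle]
    exact ⟨k, hik, hkj, rfl⟩

/-- The chain of parallel links whose vertices are the cut vertices between `u` and `v` and whose
edges are the paths joining consecutive cut vertices. -/
def cutChain (G : MultiDigraph) (u v : G.V) : MultiDigraph where
  V := {c : G.V // IsCut u v c}
  E := {q : {c : G.V // IsCut u v c} × {c : G.V // IsCut u v c} × List G.E //
    ∃ P i j, G.IsPathFrom u v P ∧ IsCutInterval u v P i j ∧ vert u P i = q.1.1 ∧
      vert u P j = q.2.1.1 ∧ seg P i j = q.2.2}
  src q := q.1.1
  tgt q := q.1.2.1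

theorem cutChain_isChainOfParallelLinks {u v : G.V} {P : List G.E} (hP : G.IsPathFrom u v P)
    (hn : P ≠ []) : (cutChain G u v).IsChainOfParallelLinks
      ⟨u, isCut_left u v⟩ ⟨v, isCut_right u v⟩ := by
  classical
  have hpos := List.length_pos_iff.2 hn
  let p : ℕ → Prop := fun k => IsCut u v (vert u P k) ∨ P.length < k
  have hinf : (Set.ofPred p).Infinite :=
    Set.infinite_of_forall_exists_gt fun n =>
      ⟨n + P.length + 1, Or.inr (by omega), by omega⟩
  have hmono := Nat.nth_strictMono hinf
  have hcut : ∀ k, k ≤ P.length → p k → IsCut u v (vert u P k) :=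
    fun k hk h => h.resolve_right (by omega)
  have hp0 : p 0 := Or.inl (by rw [vert_zero]; exact isCut_left u v)
  have hpl : p P.length := Or.inl (by rw [hP.1.vert_length]; exact isCut_right u v)
  have hm : Nat.nth p (Nat.count p P.length) = P.length := Nat.nth_count hpl
  have h0 : Nat.nth p 0 = 0 := by simpa using Nat.nth_count hp0
  have hle : ∀ i ≤ Nat.count p P.length, Nat.nth p i ≤ P.length := fun i hi => by
    rw [← hm]; exact hmono.monotone (by simpa only [hm] using hi)
  have hc : ∀ i ≤ Nat.count p P.length, IsCut u v (vert u P (Nat.nth p i)) := fun i hi =>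
    hcut _ (hle i hi) (Nat.nth_mem_of_infinite hinf i)
  have hcons : ∀ i, i < Nat.count p P.length →
      IsCutInterval u v P (Nat.nth p i) (Nat.nth p (i + 1)) := by
    intro i hi
    refine ⟨hmono (Nat.lt_succ_self i), hle _ hi, hc i hi.le, hc _ hi, fun k h1 h2 h3 => ?_⟩
    have hk : Nat.nth p (Nat.count p k) = k := Nat.nth_count (Or.inl h3)
    rw [← hk, hmono.lt_iff_lt] at h1 h2
    omega
  let w : ℕ → {c : G.V // IsCut u v c} := fun i => if h : i ≤ Nat.count p P.length then
    ⟨vert u P (Nat.nth p i), hc i h⟩ else ⟨u, isCut_left u v⟩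
  have hw : ∀ i ≤ Nat.count p P.length, (w i).1 = vert u P (Nat.nth p i) := fun i hi => by
    simp only [w, hi, dif_pos]
  refine ⟨Nat.count p P.length, w, ?_, Subtype.ext ?_, Subtype.ext ?_, ?_, ?_, ?_, ?_⟩
  · refine Nat.pos_of_ne_zero fun h => ?_
    rw [h, h0] at hm
    omega
  · exact (hw 0 (Nat.zero_le _)).trans (by rw [h0, vert_zero])
  · exact (hw _ le_rfl).trans (by rw [hm, hP.1.vert_length])
  · intro i j hi hj hij
    have h1 : (w i).1 = (w j).1 := congrArg Subtype.val hij
    rw [hw i hi, hw j hj] at h1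
    exact hmono.injective (hP.inj (hle i hi) (hle j hj) h1)
  · rintro ⟨c, hcc⟩
    obtain ⟨k, hk, rfl⟩ := mem_pathVerts.1 (hcc _ hP)
    have hck : Nat.count p k ≤ Nat.count p P.length := Nat.count_monotone p hk
    have hnk : Nat.nth p (Nat.count p k) = k := Nat.nth_count (Or.inl hcc)
    exact ⟨Nat.count p k, hck, Subtype.ext ((hw _ hck).trans (by rw [hnk]))⟩
  · rintro ⟨⟨⟨y, hy⟩, ⟨z, hz⟩, B⟩, P', i', j', hP', h', hy', hz', hB⟩
    obtain ⟨a, b, hab, ha, hb⟩ := h'.transfer hP' hP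
    have hable := hab.le
    have hna : Nat.nth p (Nat.count p a) = a := Nat.nth_count (Or.inl hab.left)
    have hnb : Nat.nth p (Nat.count p b) = b := Nat.nth_count (Or.inl hab.right)
    have hlt : Nat.count p a < Nat.count p b := by
      rw [← hmono.lt_iff_lt, hna, hnb]; exact hab.lt
    have hcb : Nat.count p b ≤ Nat.count p P.length := Nat.count_monotone p hable
    have hsucc : Nat.nth p (Nat.count p a + 1) = b := by
      have h1 : Nat.nth p (Nat.count p a + 1) ≤ b := by
        conv_rhs => rw [← hnb]
        exact hmono.monotone hlt
      have h2 : a < Nat.nth p (Nat.count p a + 1) := by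
        conv_lhs => rw [← hna]
        exact hmono (Nat.lt_succ_self _)
      by_contra hne
      exact hab.inner _ h2 (by omega) (hc _ (by omega))
    refine ⟨Nat.count p a, by omega, Subtype.ext ?_, Subtype.ext ?_⟩
    · exact ((hw _ (by omega)).trans (by rw [hna]; exact ha.trans hy')).symm
    · exact ((hw _ (by omega)).trans (by rw [hsucc]; exact hb.trans hz')).symm
  · intro i hi
    exact ⟨⟨⟨⟨_, hc i hi.le⟩, ⟨_, hc (i + 1) hi⟩, _⟩, P, _, _, hP, hcons i hi, rfl, rfl, rfl⟩,
      Subtype.ext (hw i hi.le).symm, Subtype.ext (hw (i + 1) hi).symm⟩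

end MultiDigraph

namespace MultiDigraph

/-- A homomorphism of directed multigraphs which is injective on vertices. -/
structure Embedding (U G : MultiDigraph) where
  onV : U.V → G.V
  onE : U.E → G.E
  src_onE : ∀ e, G.src (onE e) = onV (U.src e)
  tgt_onE : ∀ e, G.tgt (onE e) = onV (U.tgt e)
  inj : Function.Injective onV

namespace Embedding

variable {U G : MultiDigraph} (F : Embedding U G)

theorem isWalkFrom_map {x y : U.V} {l : List U.E} :
    G.IsWalkFrom (F.onV x) (F.onV y) (l.map F.onE) ↔ U.IsWalkFrom x y l := by
  induction l generalizing x with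
  | nil => simp [IsWalkFrom, F.inj.eq_iff]
  | cons e l ih => simp [IsWalkFrom, F.src_onE, F.tgt_onE, F.inj.eq_iff, ih]

theorem map_tgt_map (l : List U.E) : (l.map F.onE).map G.tgt = (l.map U.tgt).map F.onV := by
  simp [F.tgt_onE]

theorem pathVerts_map (x : U.V) (l : List U.E) :
    G.pathVerts (F.onV x) (l.map F.onE) = (U.pathVerts x l).map F.onV := by
  rw [pathVerts, map_tgt_map, pathVerts, List.map_cons]

theorem internals_map (l : List U.E) :
    G.internals (l.map F.onE) = (U.internals l).map F.onV := by
  rw [internals, map_tgt_map, internals, List.map_dropLast]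

theorem isPathFrom_map {x y : U.V} {l : List U.E} :
    G.IsPathFrom (F.onV x) (F.onV y) (l.map F.onE) ↔ U.IsPathFrom x y l := by
  rw [IsPathFrom, IsPathFrom, isWalkFrom_map, pathVerts_map, List.nodup_map_iff F.inj]

theorem onV_mem_internals {x : U.V} {l : List U.E} :
    F.onV x ∈ G.internals (l.map F.onE) ↔ x ∈ U.internals l := by
  rw [internals_map, List.mem_map_of_injective F.inj]

theorem onV_mem_pathVerts {x y : U.V} {l : List U.E} :
    F.onV x ∈ G.pathVerts (F.onV y) (l.map F.onE) ↔ x ∈ U.pathVerts y l := by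
  rw [pathVerts_map, List.mem_map_of_injective F.inj]

end Embedding

/-- The inclusion of the union of all `u`–`v` paths. -/
def pathUnionEmbedding (G : MultiDigraph) (u v : G.V) : Embedding (G.pathUnion u v) G where
  onV x := x.1
  onE e := e.1
  src_onE _ := rfl
  tgt_onE _ := rfl
  inj _ _ h := Subtype.ext h

variable {G : MultiDigraph}

theorem exists_map_pathUnionEmbedding {u v : G.V} {l : List G.E}
    (h : ∀ e ∈ l, e ∈ G.pathEdges u v) :
    ∃ l' : List (G.pathUnion u v).E, l'.map (G.pathUnionEmbedding u v).onE = l := by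
  induction l with
  | nil => exact ⟨[], rfl⟩
  | cons e l ih =>
    obtain ⟨l', rfl⟩ := ih fun e he => h e (List.mem_cons_of_mem _ he)
    exact ⟨(⟨e, h e (List.mem_cons_self)⟩ : (G.pathUnion u v).E) :: l', rfl⟩

theorem IsPathFrom.mem_pathUnion {u v : G.V} {P : List G.E} (hP : G.IsPathFrom u v P) {x : G.V}
    (hx : x ∈ G.pathVerts u P) :
    x = u ∨ x = v ∨ ∃ e ∈ G.pathEdges u v, G.src e = x ∨ G.tgt e = x := by
  rw [pathVerts, List.mem_cons, List.mem_map] at hx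
  rcases hx with rfl | ⟨e, he, rfl⟩
  · exact Or.inl rfl
  · exact Or.inr (Or.inr ⟨e, ⟨P, hP, he⟩, Or.inr rfl⟩)

theorem exists_path_of_mem_pathUnion {u v : G.V} {P : List G.E} (hP : G.IsPathFrom u v P)
    (x : (G.pathUnion u v).V) : ∃ Q, G.IsPathFrom u v Q ∧ x.1 ∈ G.pathVerts u Q := by
  obtain ⟨x, rfl | rfl | ⟨e, ⟨Q, hQ, he⟩, rfl | rfl⟩⟩ := x
  · exact ⟨P, hP, by simp [pathVerts]⟩
  · exact ⟨P, hP, by simp [hP.1.mem_pathVerts_iff]⟩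
  · refine ⟨Q, hQ, hQ.1.mem_pathVerts_iff.2 ?_⟩
    rcases hQ.1.src_mem he with h | h <;> simp [h]
  · refine ⟨Q, hQ, hQ.1.mem_pathVerts_iff.2 ?_⟩
    rcases hQ.1.tgt_mem he with h | h <;> simp [h]

theorem mem_seg_of_getElem? {es : List G.E} {i j k : ℕ} {a : G.E} (h : es[k]? = some a)
    (hik : i ≤ k) (hkj : k < j) : a ∈ seg es i j := by
  rw [List.mem_iff_getElem?]
  refine ⟨k - i, ?_⟩
  rw [seg, List.getElem?_take, if_pos (by omega), List.getElem?_drop,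
    Nat.add_sub_cancel' hik, h]

theorem isChainOfParallelPaths_pathUnion (hM : ¬ IsTopMinorOf M3 G)
    (hMT : ¬ IsTopMinorOf M3.transpose G) (hM' : ¬ IsTopMinorOf M3' G)
    (hM'' : ¬ IsTopMinorOf M3'' G) {u v : G.V} {P₀ : List G.E} (hP₀ : G.IsPathFrom u v P₀)
    (hn : P₀ ≠ []) :
    IsChainOfParallelPaths (G.pathUnion u v)
      ⟨u, G.mem_pathUnion_left u v⟩ ⟨v, G.mem_pathUnion_right u v⟩ := by
  let F := G.pathUnionEmbedding u v
  let φ : (cutChain G u v).V → (G.pathUnion u v).V :=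
    fun c => ⟨c.1, hP₀.mem_pathUnion (c.2 _ hP₀)⟩
  have hφ : Function.Injective φ := fun c d h => Subtype.ext (congrArg F.onV h)
  have hrange : ∀ x, x ∈ Set.range φ ↔ IsCut u v (F.onV x) := by
    intro x
    constructor
    · rintro ⟨c, rfl⟩
      exact c.2
    · intro hx
      exact ⟨⟨_, hx⟩, rfl⟩
  have hlift : ∀ e : (cutChain G u v).E, ∃ l : List (G.pathUnion u v).E,
      l.map F.onE = e.1.2.2 := by
    rintro ⟨⟨y, z, B⟩, P, i, j, hP, hI, hy, hz, hB⟩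
    refine exists_map_pathUnionEmbedding fun a ha => ⟨P, hP, ?_⟩
    change a ∈ B at ha
    rw [← show seg P i j = B from hB] at ha
    exact List.mem_of_mem_drop (List.mem_of_mem_take ha)
  choose L hL using hlift
  have hpath : ∀ e, (G.pathUnion u v).IsPathFrom (φ ((cutChain G u v).src e))
      (φ ((cutChain G u v).tgt e)) (L e) ∧ L e ≠ [] := by
    intro e
    obtain ⟨P, i, j, hP, hI, hy, hz, hB⟩ := e.2
    have hLe := (hL e).trans hB.symm
    refine ⟨F.isPathFrom_map.1 ?_, fun h => seg_ne_nil hI.lt hI.le (by rw [← hLe, h, List.map_nil])⟩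
    rw [hLe]
    have := hP.seg hI.lt.le hI.le
    rwa [hy, hz] at this
  have hinner : ∀ e, ∀ x ∈ (G.pathUnion u v).internals (L e), x ∉ Set.range φ := by
    intro e x hx
    rw [← F.onV_mem_internals, hL] at hx
    obtain ⟨P, i, j, hP, hI, hy, hz, hB⟩ := e.2
    rw [← hB, hP.1.mem_internals_seg hI.le] at hx
    obtain ⟨k, h1, h2, h3⟩ := hx
    rw [hrange, ← h3]
    exact hI.inner k h1 h2
  have hdisj : ∀ e f, e ≠ f → ∀ x ∈ (G.pathUnion u v).internals (L e),
      x ∉ (G.pathUnion u v).internals (L f) := by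
    intro e f hef x hx hx'
    rw [← F.onV_mem_internals, hL] at hx hx'
    obtain ⟨P, i, j, hP, hI, hy, hz, hB⟩ := e.2
    obtain ⟨P', i', j', hP', hI', hy', hz', hB'⟩ := f.2
    rw [← hB, hP.1.mem_internals_seg hI.le] at hx
    rw [← hB', hP'.1.mem_internals_seg hI'.le] at hx'
    obtain ⟨k, h1, h2, h3⟩ := hx
    obtain ⟨k', h1', h2', h3'⟩ := hx'
    obtain ⟨q1, q2, q3⟩ := IsCutInterval.seg_eq hM hMT hM' hM'' hP hP' hI hI' h1 h2 h1' h2'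
      (h3'.trans h3.symm)
    exact hef (Subtype.ext (Prod.ext (Subtype.ext (hy.symm.trans (q2.symm.trans hy')))
      (Prod.ext (Subtype.ext (hz.symm.trans (q3.symm.trans hz')))
        (hB.symm.trans (q1.symm.trans hB')))))
  have hpos : ∀ {P : List G.E} {i j : ℕ}, G.IsPathFrom u v P → IsCutInterval u v P i j →
      ∃ e, (L e).map F.onE = seg P i j := fun {P i j} hP hI =>
    ⟨⟨⟨⟨_, hI.left⟩, ⟨_, hI.right⟩, _⟩, P, i, j, hP, hI, rfl, rfl, rfl⟩, hL _⟩
  refine ⟨cutChain G u v, ⟨u, isCut_left u v⟩, ⟨v, isCut_right u v⟩, φ,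
    cutChain_isChainOfParallelLinks hP₀ hn,
    ⟨L, hφ, hpath, hinner, hdisj, ?_, ?_, ?_⟩, rfl, rfl⟩
  · refine edge_disjoint_of_internals hφ (fun e => (hpath e).1) hinner hdisj ?_
    intro e f hef hs ht h
    refine hef (Subtype.ext (Prod.ext hs (Prod.ext ht ?_)))
    rw [← hL e, ← hL f, h]
  · rintro ⟨a, P, hP, ha⟩
    obtain ⟨k, hk, -, -, hak⟩ := hP.1.mem_edge ha
    obtain ⟨i, j, hI, hik, hkj⟩ := exists_isCutInterval hP hk
    obtain ⟨e, he⟩ := hpos hP hI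
    have := mem_seg_of_getElem? hak hik hkj
    rw [← he, List.mem_map] at this
    obtain ⟨b, hb, hba⟩ := this
    have hb' : b = (⟨a, P, hP, ha⟩ : (G.pathUnion u v).E) := Subtype.ext hba
    exact ⟨e, hb' ▸ hb⟩
  · intro x
    by_cases hx : IsCut u v (F.onV x)
    · exact Or.inl ((hrange x).2 hx)
    · right
      obtain ⟨P, hP, hxP⟩ := exists_path_of_mem_pathUnion hP₀ x
      obtain ⟨k, hk, hkx⟩ := mem_pathVerts.1 hxP
      change vert u P k = F.onV x at hkx
      rw [← hkx] at hx
      have hkl : k ≠ P.length := by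
        rintro rfl
        rw [hP.1.vert_length] at hx
        exact hx (isCut_right u v)
      obtain ⟨i, j, hI, hik, hkj⟩ := exists_isCutInterval hP (lt_of_le_of_ne hk hkl)
      obtain ⟨e, he⟩ := hpos hP hI
      refine ⟨e, F.onV_mem_internals.1 ?_⟩
      rw [he, hP.1.mem_internals_seg hI.le]
      refine ⟨k, lt_of_le_of_ne hik ?_, hkj, hkx⟩
      rintro rfl
      exact hx hI.left

end MultiDigraph

namespace MultiDigraph

/-- In a chain of parallel paths, a vertex other than the ends with two outgoing or two incoming
edges separates the ends. -/
theorem _root_.IsChainOfParallelPaths.mem_of_walk {U : MultiDigraph} {s t x : U.V}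
    (h : IsChainOfParallelPaths U s t) (hs : x ≠ s) (ht : x ≠ t) {a b : U.E} (hab : a ≠ b)
    (hx : (U.src a = x ∧ U.src b = x) ∨ (U.tgt a = x ∧ U.tgt b = x)) {Q : List U.E}
    (hQ : U.IsWalkFrom s t Q) : x ∈ U.pathVerts s Q := by
  obtain ⟨H, s', t', φ, ⟨m, v, -, rfl, rfl, vinj, vsurj, hE, -⟩,
    ⟨P, hφ, hP, hI, hD, -, hA, hV⟩, rfl, rfl⟩ := h
  have hxφ : x ∈ Set.range φ := by
    by_contra hxr
    obtain ⟨e, he⟩ := (hV x).resolve_left hxr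
    have hs : ∀ c, U.src c = x → c ∈ P e := by
      intro c hc
      obtain ⟨f, hf⟩ := hA c
      rcases (hP f).1.1.src_mem hf with h | h
      · exact absurd ⟨_, h.symm.trans hc⟩ hxr
      · by_cases hef : f = e
        · exact hef ▸ hf
        · exact absurd he (hD f e hef x (hc ▸ h))
    have ht : ∀ c, U.tgt c = x → c ∈ P e := by
      intro c hc
      obtain ⟨f, hf⟩ := hA c
      rcases (hP f).1.1.tgt_mem hf with h | h
      · by_cases hef : f = e
        · exact hef ▸ hf
        · exact absurd he (hD f e hef x (hc ▸ h))
      · exact absurd ⟨_, h.symm.trans hc⟩ hxr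
    rcases hx with ⟨h1, h2⟩ | ⟨h1, h2⟩
    · exact hab ((hP e).1.eq_of_src_eq (hs a h1) (hs b h2) (h1.trans h2.symm))
    · exact hab ((hP e).1.eq_of_tgt_eq (ht a h1) (ht b h2) (h1.trans h2.symm))
  obtain ⟨y, rfl⟩ := hxφ
  obtain ⟨i, hi, rfl⟩ := vsurj y
  have hi0 : 0 < i := Nat.pos_of_ne_zero fun h => hs (by rw [h])
  by_contra hmem
  let S : U.V → Prop := fun y => (∃ j < i, φ (v j) = y) ∨
    ∃ e, ∃ j < i, H.src e = v j ∧ y ∈ U.internals (P e)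
  have hstep : ∀ c, S (U.src c) → U.tgt c ≠ φ (v i) → S (U.tgt c) := by
    intro c hc hne
    obtain ⟨e, hce⟩ := hA c
    obtain ⟨k, hk, hks, hkt⟩ := hE e
    have hki : k < i := by
      rcases (hP e).1.1.src_mem hce with h1 | h1 <;> rcases hc with ⟨j, hj, h2⟩ | ⟨f, j, hj, hf, h2⟩
      · rw [hks] at h1
        have := vinj j k (by omega) hk.le (hφ (h2.trans h1))
        omega
      · exact absurd ⟨_, h1.symm⟩ (hI f _ h2)
      · exact absurd ⟨_, h2⟩ (hI e _ h1)
      · by_cases hef : e = f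
        · subst hef
          have := vinj j k (by omega) hk.le (hf.symm.trans hks)
          omega
        · exact absurd h2 (hD e f hef _ h1)
    rcases (hP e).1.1.tgt_mem hce with h1 | h1
    · exact Or.inr ⟨e, k, hki, hks, h1⟩
    · rw [hkt] at h1
      refine Or.inl ⟨k + 1, lt_of_le_of_ne hki ?_, h1.symm⟩
      rintro rfl
      exact hne h1
  have hwalk : ∀ (Q : List U.E) (y z : U.V), U.IsWalkFrom y z Q → S y →
      φ (v i) ∉ U.pathVerts y Q → S z := by
    intro Q
    induction Q with
    | nil => exact fun y z h hy _ => (show y = z from h) ▸ hy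
    | cons c Q ih =>
      rintro y z ⟨rfl, h⟩ hy hn
      rw [pathVerts, List.map_cons, List.mem_cons, not_or] at hn
      exact ih _ z h (hstep c hy fun h' => hn.2 (h' ▸ List.mem_cons_self)) hn.2
  rcases hwalk Q _ _ hQ (Or.inl ⟨0, hi0, rfl⟩) hmem with ⟨j, hj, h⟩ | ⟨e, j, hj, -, h⟩
  · have := vinj j m (by omega) le_rfl (hφ h)
    omega
  · exact hI e _ h ⟨_, rfl⟩

variable {G : MultiDigraph}

theorem _root_.UsesOnlyChains.mem_of_path (hG : UsesOnlyChains G) {s t x : G.V} (hs : x ≠ s)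
    (ht : x ≠ t) {A B Q : List G.E} (hA : G.IsPathFrom s t A) (hB : G.IsPathFrom s t B)
    (hQ : G.IsPathFrom s t Q) {a b : G.E} (ha : a ∈ A) (hb : b ∈ B) (hab : a ≠ b)
    (hx : (G.src a = x ∧ G.src b = x) ∨ (G.tgt a = x ∧ G.tgt b = x)) : x ∈ G.pathVerts s Q := by
  have hU := (hG s t).resolve_left fun h => h ⟨A, hA, List.ne_nil_of_mem ha⟩
  let F := G.pathUnionEmbedding s t
  let a' : (G.pathUnion s t).E := ⟨a, A, hA, ha⟩
  let b' : (G.pathUnion s t).E := ⟨b, B, hB, hb⟩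
  obtain ⟨x', rfl⟩ : ∃ x' : (G.pathUnion s t).V, F.onV x' = x := by
    rcases hx with hx | hx
    · exact ⟨(G.pathUnion s t).src a', hx.1⟩
    · exact ⟨(G.pathUnion s t).tgt a', hx.1⟩
  obtain ⟨Q', rfl⟩ := exists_map_pathUnionEmbedding (l := Q) fun e he => ⟨Q, hQ, he⟩
  refine F.onV_mem_pathVerts.2 (hU.mem_of_walk (fun h => hs (congrArg F.onV h))
    (fun h => ht (congrArg F.onV h)) (a := a') (b := b') (fun h => hab (congrArg F.onE h)) ?_
    (F.isWalkFrom_map.1 hQ.1))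
  rcases hx with ⟨h1, h2⟩ | ⟨h1, h2⟩
  · exact Or.inl ⟨F.inj h1, F.inj h2⟩
  · exact Or.inr ⟨F.inj h1, F.inj h2⟩

theorem IsWalkFrom.exists_src_eq {u v : G.V} {es : List G.E} (h : G.IsWalkFrom u v es)
    (hn : es ≠ []) : ∃ a ∈ es, G.src a = u := by
  cases es with
  | nil => exact absurd rfl hn
  | cons a es => exact ⟨a, List.mem_cons_self, h.1⟩

theorem IsWalkFrom.exists_tgt_eq {u v : G.V} {es : List G.E} (h : G.IsWalkFrom u v es)
    (hn : es ≠ []) : ∃ a ∈ es, G.tgt a = v :=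
  List.mem_map.1 ((h.mem_map_tgt_iff hn).2 (Or.inr rfl))

/-- A topological minor on `Fin k` and `Fin n`, spelled out. -/
theorem exists_of_isTopMinorOf_fin {k n : ℕ} {src tgt : Fin n → Fin k}
    (h : IsTopMinorOf ⟨Fin k, Fin n, src, tgt⟩ G) :
    ∃ (φ : Fin k → G.V) (P : Fin n → List G.E), (∀ i j, i ≠ j → φ i ≠ φ j) ∧
      (∀ e, G.IsPathFrom (φ (src e)) (φ (tgt e)) (P e)) ∧ (∀ e, P e ≠ []) ∧
      (∀ e i, φ i ∉ G.internals (P e)) ∧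
      (∀ e f, e ≠ f → ∀ x ∈ G.internals (P e), x ∉ G.internals (P f)) ∧
      (∀ e f, e ≠ f → ∀ a ∈ P e, ∀ b ∈ P f, a ≠ b) := by
  obtain ⟨φ, P, hφ, hP, hI, hD, hE⟩ := h
  exact ⟨φ, P, fun i j h => hφ.ne h, fun e => (hP e).1, fun e => (hP e).2,
    fun e i h => hI e _ h ⟨i, rfl⟩, hD, fun e f hef a ha b hb hab => hE e f hef a ha (hab ▸ hb)⟩

theorem _root_.UsesOnlyChains.not_isTopMinorOf_M3 (hG : UsesOnlyChains G) :
    ¬ IsTopMinorOf M3 G := by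
  intro h
  obtain ⟨φ, P, hφ, hP, hn, hI, hD, hE⟩ :=
    exists_of_isTopMinorOf_fin (src := ![0, 1, 0, 1]) (tgt := ![1, 2, 2, 2]) h
  have h0 : G.IsPathFrom (φ 0) (φ 1) (P 0) := hP 0
  have h1 : G.IsPathFrom (φ 1) (φ 2) (P 1) := hP 1
  have h2 : G.IsPathFrom (φ 0) (φ 2) (P 2) := hP 2
  have h3 : G.IsPathFrom (φ 1) (φ 2) (P 3) := hP 3
  obtain ⟨a, ha, hax⟩ := h1.1.exists_src_eq (hn 1)
  obtain ⟨b, hb, hbx⟩ := h3.1.exists_src_eq (hn 3)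
  have hA := h0.append' h1 (hn 1) (hφ 0 2 (by decide)) (hI 1 0) (hI 0 2) (hD 0 1 (by decide))
  have hB := h0.append' h3 (hn 3) (hφ 0 2 (by decide)) (hI 3 0) (hI 0 2) (hD 0 3 (by decide))
  have := hG.mem_of_path (hφ 1 0 (by decide)) (hφ 1 2 (by decide)) hA hB h2
    (List.mem_append_right _ ha) (List.mem_append_right _ hb) (hE 1 3 (by decide) a ha b hb)
    (Or.inl ⟨hax, hbx⟩)
  rw [h2.1.mem_pathVerts_iff] at this
  exact this.elim (hφ 1 0 (by decide)) fun h => h.elim (hI 2 1) (hφ 1 2 (by decide))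

theorem _root_.UsesOnlyChains.not_isTopMinorOf_M3_transpose (hG : UsesOnlyChains G) :
    ¬ IsTopMinorOf M3.transpose G := by
  intro h
  obtain ⟨φ, P, hφ, hP, hn, hI, hD, hE⟩ :=
    exists_of_isTopMinorOf_fin (src := ![1, 2, 2, 2]) (tgt := ![0, 1, 0, 1]) h
  have h0 : G.IsPathFrom (φ 1) (φ 0) (P 0) := hP 0
  have h1 : G.IsPathFrom (φ 2) (φ 1) (P 1) := hP 1
  have h2 : G.IsPathFrom (φ 2) (φ 0) (P 2) := hP 2
  have h3 : G.IsPathFrom (φ 2) (φ 1) (P 3) := hP 3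
  obtain ⟨a, ha, hax⟩ := h1.1.exists_tgt_eq (hn 1)
  obtain ⟨b, hb, hbx⟩ := h3.1.exists_tgt_eq (hn 3)
  have hA := h1.append' h0 (hn 0) (hφ 2 0 (by decide)) (hI 0 2) (hI 1 0) (hD 1 0 (by decide))
  have hB := h3.append' h0 (hn 0) (hφ 2 0 (by decide)) (hI 0 2) (hI 3 0) (hD 3 0 (by decide))
  have := hG.mem_of_path (hφ 1 2 (by decide)) (hφ 1 0 (by decide)) hA hB h2
    (List.mem_append_left _ ha) (List.mem_append_left _ hb) (hE 1 3 (by decide) a ha b hb)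
    (Or.inr ⟨hax, hbx⟩)
  rw [h2.1.mem_pathVerts_iff] at this
  exact this.elim (hφ 1 2 (by decide)) fun h => h.elim (hI 2 1) (hφ 1 0 (by decide))

theorem _root_.UsesOnlyChains.not_isTopMinorOf_M3' (hG : UsesOnlyChains G) :
    ¬ IsTopMinorOf M3' G := by
  intro h
  obtain ⟨φ, P, hφ, hP, hn, hI, hD, hE⟩ :=
    exists_of_isTopMinorOf_fin (src := ![0, 1, 2, 0, 1]) (tgt := ![1, 2, 3, 3, 2]) h
  have h0 : G.IsPathFrom (φ 0) (φ 1) (P 0) := hP 0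
  have h1 : G.IsPathFrom (φ 1) (φ 2) (P 1) := hP 1
  have h2 : G.IsPathFrom (φ 2) (φ 3) (P 2) := hP 2
  have h3 : G.IsPathFrom (φ 0) (φ 3) (P 3) := hP 3
  have h4 : G.IsPathFrom (φ 1) (φ 2) (P 4) := hP 4
  obtain ⟨a, ha, hax⟩ := h1.1.exists_src_eq (hn 1)
  obtain ⟨b, hb, hbx⟩ := h4.1.exists_src_eq (hn 4)
  have key : ∀ e, e = 1 ∨ e = 4 → G.IsPathFrom (φ 1) (φ 2) (P e) →
      G.IsPathFrom (φ 0) (φ 3) (P 0 ++ P e ++ P 2) := by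
    intro e he h
    have he0 : 0 ≠ e := by rcases he with rfl | rfl <;> decide
    have he2 : e ≠ 2 := by rcases he with rfl | rfl <;> decide
    refine (h0.append' h (hn e) (hφ 0 2 (by decide)) (hI e 0) (hI 0 2) (hD 0 e he0)).append' h2
      (hn 2) (hφ 0 3 (by decide)) (hI 2 0) ?_ fun x hx => ?_
    · rw [h0.1.mem_internals_append (hn 0) (hn e)]
      rintro (h | h | h)
      exacts [hI 0 3 h, hφ 3 1 (by decide) h, hI e 3 h]
    · rw [h0.1.mem_internals_append (hn 0) (hn e)] at hx
      rcases hx with h | rfl | h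
      exacts [hD 0 2 (by decide) x h, hI 2 1, hD e 2 he2 x h]
  have := hG.mem_of_path (hφ 1 0 (by decide)) (hφ 1 3 (by decide)) (key 1 (Or.inl rfl) h1)
    (key 4 (Or.inr rfl) h4) h3 (List.mem_append_left _ (List.mem_append_right _ ha))
    (List.mem_append_left _ (List.mem_append_right _ hb)) (hE 1 4 (by decide) a ha b hb)
    (Or.inl ⟨hax, hbx⟩)
  rw [h3.1.mem_pathVerts_iff] at this
  exact this.elim (hφ 1 0 (by decide)) fun h => h.elim (hI 3 1) (hφ 1 3 (by decide))

theorem _root_.UsesOnlyChains.not_isTopMinorOf_M3'' (hG : UsesOnlyChains G) :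
    ¬ IsTopMinorOf M3'' G := by
  intro h
  obtain ⟨φ, P, hφ, hP, hn, hI, hD, hE⟩ :=
    exists_of_isTopMinorOf_fin (src := ![0, 1, 0, 2, 1]) (tgt := ![1, 3, 2, 3, 2]) h
  have h0 : G.IsPathFrom (φ 0) (φ 1) (P 0) := hP 0
  have h1 : G.IsPathFrom (φ 1) (φ 3) (P 1) := hP 1
  have h2 : G.IsPathFrom (φ 0) (φ 2) (P 2) := hP 2
  have h3 : G.IsPathFrom (φ 2) (φ 3) (P 3) := hP 3
  have h4 : G.IsPathFrom (φ 1) (φ 2) (P 4) := hP 4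
  obtain ⟨a, ha, hax⟩ := h1.1.exists_src_eq (hn 1)
  obtain ⟨b, hb, hbx⟩ := h4.1.exists_src_eq (hn 4)
  have hA := h0.append' h1 (hn 1) (hφ 0 3 (by decide)) (hI 1 0) (hI 0 3) (hD 0 1 (by decide))
  have hQ := h2.append' h3 (hn 3) (hφ 0 3 (by decide)) (hI 3 0) (hI 2 3) (hD 2 3 (by decide))
  have hB := (h0.append' h4 (hn 4) (hφ 0 2 (by decide)) (hI 4 0) (hI 0 2)
    (hD 0 4 (by decide))).append' h3 (hn 3) (hφ 0 3 (by decide)) (hI 3 0)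
      (by
        rw [h0.1.mem_internals_append (hn 0) (hn 4)]
        rintro (h | h | h)
        exacts [hI 0 3 h, hφ 3 1 (by decide) h, hI 4 3 h])
      (fun x hx => by
        rw [h0.1.mem_internals_append (hn 0) (hn 4)] at hx
        rcases hx with h | rfl | h
        exacts [hD 0 3 (by decide) x h, hI 3 1, hD 4 3 (by decide) x h])
  have := hG.mem_of_path (hφ 1 0 (by decide)) (hφ 1 3 (by decide)) hA hB hQ
    (List.mem_append_right _ ha) (List.mem_append_left _ (List.mem_append_right _ hb))
    (hE 1 4 (by decide) a ha b hb) (Or.inl ⟨hax, hbx⟩)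
  rw [hQ.1.mem_pathVerts_iff, h2.1.mem_internals_append (hn 2) (hn 3)] at this
  rcases this with h | (h | h | h) | h
  exacts [hφ 1 0 (by decide) h, hI 2 1 h, hφ 1 2 (by decide) h, hI 3 1 h, hφ 1 3 (by decide) h]

end MultiDigraph

/-- A directed graph `G` uses only chains of parallel paths if and only if `G`
contains none of `M₃`, `M₃ᵀ`, `M₃′`, `M₃″` as a topological minor. -/
theorem stmt8 (G : MultiDigraph) :
    UsesOnlyChains G ↔
      ¬ IsTopMinorOf M3 G ∧ ¬ IsTopMinorOf M3.transpose G ∧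
      ¬ IsTopMinorOf M3' G ∧ ¬ IsTopMinorOf M3'' G := by
  refine ⟨fun h => ⟨h.not_isTopMinorOf_M3, h.not_isTopMinorOf_M3_transpose,
    h.not_isTopMinorOf_M3', h.not_isTopMinorOf_M3''⟩, fun ⟨hM, hMT, hM', hM''⟩ u v => ?_⟩
  refine or_iff_not_imp_left.2 fun h => ?_
  obtain ⟨P, hP, hn⟩ := not_not.1 h
  exact isChainOfParallelPaths_pathUnion hM hMT hM' hM'' hP hn
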